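/- For every prime p there exist positive integers ℓ, n and c_0, …, c_{2p−1} with the following property. Let G be the group with generators x_{i,1}, …, x_{i,ℓ} for i = 0, …, 2p−1 and y_{i,1}, …, y_{i,ℓ+c_i} for i = 0, …, 2p−1, writing x_i := [x_{i,1}, …, x_{i,ℓ}] and y_i := [y_{i,1}, …, y_{i,ℓ+c_i}] for the left-normed iterated commutators, subject to the relations x_0 x_1 ⋯ x_{2p−1} = 1 and x_i^{p^{c_i}} = y_i for i = 0, …, 2p−1 (i.e. G is the quotient of the free group on all listed generators by the normal closure of these relators). Then there is an element g ∈ G with g ∈ δ_n(G), g ∉ γ_n(G) and g^p ∈ γ_n(G), so δ_n(G)/γ_n(G) contains an element of order p. -/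

import Mathlib

/-- The augmentation ideal of the integral group ring `ℤG`. -/
noncomputable def augIdeal (G : Type*) [Group G] : Submodule ℤ (MonoidAlgebra ℤ G) :=
  Submodule.restrictScalars ℤ
    (RingHom.ker ((MonoidAlgebra.lift ℤ ℤ G) 1).toRingHom)

/-- The `n`-th dimension subgroup `δ_n(G) = {g ∈ G : g - 1 ∈ ϖ^n}`. -/
noncomputable def dimensionSubgroup (G : Type*) [Group G] (n : ℕ) : Set G :=
  {g : G | (MonoidAlgebra.of ℤ G g : MonoidAlgebra ℤ G) - 1 ∈ (augIdeal G) ^ n}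

/-- `γ_n(G)`, the `n`-th term of the lower central series, with `γ_1(G) = G`. -/
def gammaGrp (G : Type*) [Group G] (n : ℕ) : Subgroup G := (⊤ : Subgroup G).lowerCentralSeries (n - 1)

open scoped commutatorElement

/-- Left-normed iterated commutator `[g₁, g₂, …, g_d]` of a list of group elements. -/
def leftComm {G : Type*} [Group G] : List G → G
  | [] => 1
  | a :: l => l.foldl (fun x y => ⁅x, y⁆) a

/-- The generating set: `x_{i,1}, …, x_{i,ℓ}` and `y_{i,1}, …, y_{i,ℓ+cᵢ}` for
`i = 0, …, 2p-1`. -/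
abbrev MainGen (p ℓ : ℕ) (c : Fin (2 * p) → ℕ) : Type :=
  (Fin (2 * p) × Fin ℓ) ⊕ ((i : Fin (2 * p)) × Fin (ℓ + c i))

/-- `x_i`, the left-normed commutator `[x_{i,1}, …, x_{i,ℓ}]` in the free group. -/
def xWord (p ℓ : ℕ) (c : Fin (2 * p) → ℕ) (i : Fin (2 * p)) : FreeGroup (MainGen p ℓ c) :=
  leftComm (List.ofFn fun j : Fin ℓ => FreeGroup.of (Sum.inl (i, j)))

/-- `y_i`, the left-normed commutator `[y_{i,1}, …, y_{i,ℓ+cᵢ}]` in the free group. -/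
def yWord (p ℓ : ℕ) (c : Fin (2 * p) → ℕ) (i : Fin (2 * p)) : FreeGroup (MainGen p ℓ c) :=
  leftComm (List.ofFn fun j : Fin (ℓ + c i) => FreeGroup.of (Sum.inr ⟨i, j⟩))

/-- The relators: `x_0 x_1 ⋯ x_{2p-1}` and `x_i^{p^{cᵢ}} y_i⁻¹` for all `i`. -/
def mainRels (p ℓ : ℕ) (c : Fin (2 * p) → ℕ) : Set (FreeGroup (MainGen p ℓ c)) :=
  insert (List.ofFn fun i : Fin (2 * p) => xWord p ℓ c i).prod
    {w | ∃ i : Fin (2 * p), w = (xWord p ℓ c i) ^ (p ^ (c i)) * (yWord p ℓ c i)⁻¹}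

/-- The group of the Main Theorem: the quotient of the free group on the listed
generators by the normal closure of the relators. -/
def MainGroup (p ℓ : ℕ) (c : Fin (2 * p) → ℕ) : Type :=
  PresentedGroup (mainRels p ℓ c)

instance (p ℓ : ℕ) (c : Fin (2 * p) → ℕ) : Group (MainGroup p ℓ c) :=
  inferInstanceAs (Group (PresentedGroup (mainRels p ℓ c)))

open scoped commutatorElement

structure NSer {N : Type} [Group N] (D : ℕ → Subgroup N) : Prop where
  top : D 1 = ⊤
  anti : ∀ i j, 1 ≤ i → i ≤ j → D j ≤ D i
  comm : ∀ i j, 1 ≤ i → 1 ≤ j → ∀ a ∈ D i, ∀ b ∈ D j, ⁅a, b⁆ ∈ D (i + j)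

theorem NSer.gamma_le {N : Type} [Group N] {D : ℕ → Subgroup N} (h : NSer D) (n : ℕ) :
    (⊤ : Subgroup N).lowerCentralSeries n ≤ D (n + 1) := by
  induction n with
  | zero => simp [h.top]
  | succ n ih =>
    rw [Subgroup.lowerCentralSeries_succ, Subgroup.commutator_le]
    intro a ha b _
    exact h.comm (n + 1) 1 (by omega) le_rfl a (ih ha) b (by simp [h.top])

section Root
variable {N : Type} [Group N]

inductive InD (D : ℕ → Subgroup N) (w : ℕ) : ℕ → Monoid.Coprod N (Multiplicative ℤ) → Prop
  | base (k : ℕ) (hk : 1 ≤ k) (n : N) (hn : n ∈ D k) : InD D w k (Monoid.Coprod.inl n)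
  | gen : InD D w (w - 1) (Monoid.Coprod.inr (Multiplicative.ofAdd 1))
  | one (k : ℕ) : InD D w k 1
  | mul (k : ℕ) (a b) : InD D w k a → InD D w k b → InD D w k (a * b)
  | inv (k : ℕ) (a) : InD D w k a → InD D w k a⁻¹
  | mono (i j : ℕ) (hi : 1 ≤ i) (hij : i ≤ j) (a) : InD D w j a → InD D w i a
  | comm (i j : ℕ) (hi : 1 ≤ i) (hj : 1 ≤ j) (a b) : InD D w i a → InD D w j b →
      InD D w (i + j) ⁅a, b⁆

variable {D : ℕ → Subgroup N} {w : ℕ}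

theorem InD.all (h : NSer D) (hw : 2 ≤ w) (a) : InD D w 1 a := by
  have hz : ∀ z : Multiplicative ℤ, InD D w 1 (Monoid.Coprod.inr z) := by
    have h1 : InD D w 1 (Monoid.Coprod.inr (Multiplicative.ofAdd 1)) :=
      InD.mono 1 (w - 1) le_rfl (by omega) _ InD.gen
    intro z
    have : z = (Multiplicative.ofAdd (1 : ℤ)) ^ (Multiplicative.toAdd z) := by
      rw [← ofAdd_zsmul]; simp
    rw [this, map_zpow]
    generalize Multiplicative.toAdd z = k
    have hn : ∀ n : ℕ, InD D w 1 ((Monoid.Coprod.inr (Multiplicative.ofAdd (1 : ℤ)) :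
        Monoid.Coprod N (Multiplicative ℤ)) ^ n) := by
      intro n
      induction n with
      | zero => simpa using InD.one 1
      | succ n ih => rw [pow_succ]; exact InD.mul _ _ _ ih h1
    cases k with
    | ofNat n => simpa using hn n
    | negSucc n => rw [zpow_negSucc]; exact InD.inv _ _ (hn _)
  induction a using Monoid.Coprod.induction_on with
  | inl m => exact InD.base 1 le_rfl m (by simp [h.top])
  | inr z => exact hz z
  | mul x y hx hy => exact InD.mul _ _ _ hx hy

theorem InD.conj (h : NSer D) (hw : 2 ≤ w) {k : ℕ} (hk : 1 ≤ k) {a} (ha : InD D w k a) (g) :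
    InD D w k (g * a * g⁻¹) := by
  have : g * a * g⁻¹ = ⁅g, a⁆ * a := by simp [commutatorElement_def]
  rw [this]
  exact InD.mul _ _ _ (InD.mono _ (1 + k) hk (by omega) _
    (InD.comm 1 k le_rfl hk _ _ (InD.all h hw g) ha)) ha

theorem InD.ret (h : NSer D) {k : ℕ} {a} (ha : InD D w k a) :
    Monoid.Coprod.lift (MonoidHom.id N) (1 : Multiplicative ℤ →* N) a ∈ D k := by
  induction ha with
  | base k hk n hn => simpa using hn
  | gen => simp [one_mem]
  | one k => simp [one_mem]
  | mul k a b _ _ h1 h2 => rw [map_mul]; exact mul_mem h1 h2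
  | inv k a _ h1 => rw [map_inv]; exact inv_mem h1
  | mono i j hi hij a _ h1 => exact h.anti i j hi hij h1
  | comm i j hi hj a b _ _ h1 h2 => rw [map_commutatorElement]; exact h.comm i j hi hj _ h1 _ h2

def InDsub (D : ℕ → Subgroup N) (w k : ℕ) : Subgroup (Monoid.Coprod N (Multiplicative ℤ)) where
  carrier := {a | InD D w k a}
  one_mem' := InD.one k
  mul_mem' := fun h1 h2 => InD.mul _ _ _ h1 h2
  inv_mem' := fun h1 => InD.inv _ _ h1

theorem InD.shift (h : NSer D) (hw : 2 ≤ w) (σ : Monoid.Coprod N (Multiplicative ℤ) →*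
    Monoid.Coprod N (Multiplicative ℤ)) (h1 : ∀ n, σ (Monoid.Coprod.inl n) = Monoid.Coprod.inl n)
    (h2 : ∃ y ∈ D w, σ (Monoid.Coprod.inr (Multiplicative.ofAdd 1)) =
      Monoid.Coprod.inl y * Monoid.Coprod.inr (Multiplicative.ofAdd 1)) {k : ℕ} {a}
    (ha : InD D w k a) : InD D w (k + 1) (σ a * a⁻¹) := by
  induction ha with
  | base k hk n hn => rw [h1]; simpa using InD.one _
  | gen =>
    obtain ⟨y, hy, e⟩ := h2
    rw [e, mul_inv_cancel_right]
    have : w - 1 + 1 = w := by omega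
    rw [this]
    exact InD.base w (by omega) y hy
  | one k => simpa using InD.one _
  | mul k a b _ _ ha hb =>
    have : σ (a * b) * (a * b)⁻¹ = (σ a * a⁻¹) * (a * (σ b * b⁻¹) * a⁻¹) := by
      rw [map_mul]; group
    rw [this]
    exact InD.mul _ _ _ ha (InD.conj h hw (by omega) hb a)
  | inv k a _ ha =>
    have : σ a⁻¹ * a⁻¹⁻¹ = (σ a)⁻¹ * (σ a * a⁻¹)⁻¹ * (σ a)⁻¹⁻¹ := by
      rw [map_inv]; group
    rw [this]
    exact InD.conj h hw (by omega) (InD.inv _ _ ha) _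
  | mono i j hi hij a _ ha => exact InD.mono _ _ (by omega) (by omega) _ ha
  | comm i j hi hj a b ha0 hb0 ha hb =>
    obtain ⟨z, hz⟩ : ∃ z, z = σ a * a⁻¹ := ⟨_, rfl⟩
    obtain ⟨y, hy⟩ : ∃ y, y = σ b * b⁻¹ := ⟨_, rfl⟩
    rw [← hz] at ha
    rw [← hy] at hb
    have ea : σ a = z * a := by rw [hz]; group
    have eb : σ b = y * b := by rw [hy]; group
    rw [map_commutatorElement, ea, eb]
    have key : ⁅z * a, y * b⁆ * ⁅a, b⁆⁻¹ = ⁅z, a * (y * b) * a⁻¹⁆ * ⁅a, y⁆ * ⁅y, ⁅a, b⁆⁆ := by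
      simp only [commutatorElement_def]; group
    rw [key]
    have hyb : InD D w j (y * b) := InD.mul _ _ _ (InD.mono _ (j + 1) hj (by omega) _ hb) hb0
    refine InD.mul _ _ _ (InD.mul _ _ _ ?_ ?_) ?_
    · exact InD.mono _ (i + 1 + j) (by omega) (by omega) _
        (InD.comm _ _ (by omega) hj _ _ ha (InD.conj h hw hj hyb a))
    · exact InD.comm i (j + 1) hi (by omega) _ _ ha0 hb
    · exact InD.mono _ (j + 1 + (i + j)) (by omega) (by omega) _
        (InD.comm _ _ (by omega) (by omega) _ _ hb (InD.comm i j hi hj _ _ ha0 hb0))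

noncomputable def rootHom (x : N) : Monoid.Coprod N (Multiplicative ℤ) →*
    Monoid.Coprod N (Multiplicative ℤ) :=
  Monoid.Coprod.lift Monoid.Coprod.inl
    (zpowersHom _ (Monoid.Coprod.inl x * Monoid.Coprod.inr (Multiplicative.ofAdd (1 : ℤ))))

theorem rootHom_inl (x n : N) : rootHom x (Monoid.Coprod.inl n) = Monoid.Coprod.inl n := by
  simp [rootHom]

theorem rootHom_inr (x : N) : rootHom x (Monoid.Coprod.inr (Multiplicative.ofAdd 1)) =
    Monoid.Coprod.inl x * Monoid.Coprod.inr (Multiplicative.ofAdd 1) := by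
  simp [rootHom]

theorem rootHom_comp (x y : N) (h : x * y = 1) :
    (rootHom x).comp (rootHom y) = MonoidHom.id _ := by
  apply Monoid.Coprod.hom_ext
  · ext n; simp [rootHom_inl]
  · ext
    have : y * x = 1 := by rw [mul_eq_one_iff_eq_inv] at h ⊢; rw [h]; simp
    simp only [MonoidHom.comp_apply, rootHom_inr, map_mul, rootHom_inl, MonoidHom.id_apply]
    rw [← mul_assoc, ← map_mul, this, map_one, one_mul]

noncomputable def rootAut (x : N) : MulAut (Monoid.Coprod N (Multiplicative ℤ)) where
  toFun := rootHom x⁻¹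
  invFun := rootHom x
  left_inv := fun a => DFunLike.congr_fun (rootHom_comp x x⁻¹ (by simp)) a
  right_inv := fun a => DFunLike.congr_fun (rootHom_comp x⁻¹ x (by simp)) a
  map_mul' := map_mul _

def rootStab (D : ℕ → Subgroup N) (w : ℕ) :
    Subgroup (MulAut (Monoid.Coprod N (Multiplicative ℤ))) where
  carrier := {σ | (∀ n, σ (Monoid.Coprod.inl n) = Monoid.Coprod.inl n) ∧
    ∃ y ∈ D w, σ (Monoid.Coprod.inr (Multiplicative.ofAdd 1)) =
      Monoid.Coprod.inl y * Monoid.Coprod.inr (Multiplicative.ofAdd 1)}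
  one_mem' := ⟨fun n => rfl, 1, one_mem _, by simp⟩
  mul_mem' := by
    rintro σ τ ⟨h1, y, hy, h2⟩ ⟨h3, y', hy', h4⟩
    refine ⟨fun n => by rw [MulAut.mul_apply, h3, h1], y' * y, mul_mem hy' hy, ?_⟩
    rw [MulAut.mul_apply, h4, map_mul, h1, h2, map_mul, mul_assoc]
  inv_mem' := by
    rintro σ ⟨h1, y, hy, h2⟩
    have h3 : ∀ n, σ⁻¹ (Monoid.Coprod.inl n) = Monoid.Coprod.inl n := by
      intro n
      conv_lhs => rw [← h1 n]
      exact MulAut.inv_apply_self _ σ _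
    refine ⟨h3, y⁻¹, inv_mem hy, ?_⟩
    have := congrArg (fun z => (σ⁻¹ : MulAut _) z) h2
    rw [MulAut.inv_apply_self, map_mul, h3] at this
    rw [map_inv, eq_inv_mul_iff_mul_eq, ← this]

noncomputable def rootAct (x : N) : Multiplicative ℤ →*
    MulAut (Monoid.Coprod N (Multiplicative ℤ)) := zpowersHom _ (rootAut x)

theorem rootAct_mem {x : N} (hx : x ∈ D w) (s : Multiplicative ℤ) :
    rootAct x s ∈ rootStab D w := by
  rw [rootAct, zpowersHom_apply]
  apply zpow_mem
  exact ⟨fun n => rootHom_inl x⁻¹ n, x⁻¹, inv_mem hx, rootHom_inr x⁻¹⟩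

abbrev RootGrp (x : N) : Type := Monoid.Coprod N (Multiplicative ℤ) ⋊[rootAct x] Multiplicative ℤ

noncomputable def RootD (D : ℕ → Subgroup N) (w : ℕ) (x : N) (k : ℕ) : Subgroup (RootGrp x) :=
  if k ≤ 1 then ⊤ else (InDsub D w k).map SemidirectProduct.inl

theorem mem_RootD (h : NSer D) (hw : 2 ≤ w) (x : N) (k : ℕ) (hk : 1 ≤ k) (q : RootGrp x) :
    q ∈ RootD D w x k ↔ InD D w k q.left ∧ (2 ≤ k → q.right = 1) := by
  unfold RootD
  split_ifs with h1
  · have : k = 1 := by omega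
    subst this
    simp [InD.all h hw]
  · constructor
    · rintro ⟨a, ha, rfl⟩
      exact ⟨ha, fun _ => rfl⟩
    · rintro ⟨ha, hb⟩
      refine ⟨q.left, ha, ?_⟩
      ext
      · simp
      · simp [hb (by omega)]

theorem RootD_NSer (h : NSer D) (hw : 2 ≤ w) (x : N) (hx : x ∈ D w) : NSer (RootD D w x) where
  top := by simp [RootD]
  anti := by
    intro i j hi hij q hq
    rw [mem_RootD h hw x _ (by omega)] at hq ⊢
    exact ⟨InD.mono _ _ hi hij _ hq.1, fun h' => hq.2 (by omega)⟩
  comm := by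
    intro i j hi hj q hq r hr
    rw [mem_RootD h hw x _ (by omega)] at hq hr ⊢
    have sh : ∀ (s : Multiplicative ℤ) (i j : ℕ) (_ : 1 ≤ i) (_ : 2 ≤ i → s = 1) (b)
        (_ : InD D w j b), InD D w (i + j) (rootAct x s b * b⁻¹) := by
      intro s i j hi hs b hb
      by_cases h2 : 2 ≤ i
      · rw [hs h2]; simpa using InD.one _
      · have : i = 1 := by omega
        subst this
        rw [add_comm]
        obtain ⟨e1, e2⟩ := rootAct_mem hx s
        exact InD.shift h hw (rootAct x s).toMonoidHom e1 e2 hb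
    have hr' : ⁅q, r⁆.right = 1 := by
      simp [commutatorElement_def]
    refine ⟨?_, fun _ => hr'⟩
    have e : ⁅q, r⁆ * (r * q) = q * r := by simp [commutatorElement_def]
    have el := congrArg SemidirectProduct.left e
    rw [SemidirectProduct.mul_left, hr', map_one, MulAut.one_apply, SemidirectProduct.mul_left,
      SemidirectProduct.mul_left] at el
    have z1 := sh q.right i j hi hq.2 _ hr.1
    have z2 := sh r.right j i hj hr.2 _ hq.1
    rw [add_comm] at z2
    have : ⁅q, r⁆.left = (q.left * (rootAct x q.right r.left * r.left⁻¹) * q.left⁻¹) *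
        ⁅q.left, r.left⁆ * (r.left * (rootAct x r.right q.left * q.left⁻¹)⁻¹ * r.left⁻¹) := by
      rw [eq_mul_inv_of_mul_eq el, commutatorElement_def]; group
    rw [this]
    exact InD.mul _ _ _ (InD.mul _ _ _ (InD.conj h hw (by omega) z1 _)
      (InD.comm _ _ hi hj _ _ hq.1 hr.1)) (InD.conj h hw (by omega) (InD.inv _ _ z2) _)

end Root

/-- strict embedding of N-series -/
def NExt {N N' : Type} [Group N] [Group N'] (D : ℕ → Subgroup N) (D' : ℕ → Subgroup N')
    (f : N →* N') : Prop := ∀ k, 1 ≤ k → ∀ a, a ∈ D k ↔ f a ∈ D' k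

theorem root_adjoin {N : Type} [Group N] {D : ℕ → Subgroup N} (h : NSer D) {w : ℕ} (hw : 2 ≤ w)
    {x : N} (hx : x ∈ D w) : ∃ (N' : Type) (_ : Group N') (D' : ℕ → Subgroup N') (f : N →* N')
      (u t : N'), NSer D' ∧ NExt D D' f ∧ u ∈ D' (w - 1) ∧ ⁅u, t⁆ = f x := by
  refine ⟨RootGrp x, inferInstance, RootD D w x,
    (SemidirectProduct.inl).comp Monoid.Coprod.inl,
    SemidirectProduct.inl (Monoid.Coprod.inr (Multiplicative.ofAdd 1)),
    SemidirectProduct.inr (Multiplicative.ofAdd 1), RootD_NSer h hw x hx, ?_, ?_, ?_⟩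
  · intro k hk a
    rw [mem_RootD h hw x _ hk]
    constructor
    · intro ha
      exact ⟨InD.base _ hk _ ha, fun _ => rfl⟩
    · rintro ⟨ha, -⟩
      simpa using InD.ret h ha
  · rw [mem_RootD h hw x _ (by omega)]
    exact ⟨InD.gen, fun _ => rfl⟩
  · rw [commutatorElement_def, mul_assoc, mul_assoc, ← mul_assoc (SemidirectProduct.inr _),
      ← map_inv SemidirectProduct.inl, ← map_inv SemidirectProduct.inr,
      ← SemidirectProduct.inl_aut, ← map_mul]
    simp only [MonoidHom.comp_apply]
    congr 1
    rw [rootAct, zpowersHom_apply]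
    simp only [toAdd_ofAdd, zpow_one, map_inv]
    have e : rootAut x (Monoid.Coprod.inr (Multiplicative.ofAdd 1)) =
      Monoid.Coprod.inl x⁻¹ * Monoid.Coprod.inr (Multiplicative.ofAdd 1) := rootHom_inr x⁻¹
    rw [e]
    simp

theorem leftComm_append {G : Type*} [Group G] (l : List G) (h : l ≠ []) (a : G) :
    leftComm (l ++ [a]) = ⁅leftComm l, a⁆ := by
  cases l with
  | nil => exact absurd rfl h
  | cons b l => simp [leftComm]

theorem leftComm_map {G H : Type*} [Group G] [Group H] (f : G →* H) (l : List G) :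
    f (leftComm l) = leftComm (l.map f) := by
  induction l using List.reverseRecOn with
  | nil => simp [leftComm]
  | append_singleton l a ih =>
    by_cases h : l = []
    · subst h; simp [leftComm]
    · rw [leftComm_append _ h, map_commutatorElement, ih, List.map_append, List.map_singleton,
        leftComm_append _ (by simpa using h)]

theorem NExt.comp {N N' N'' : Type} [Group N] [Group N'] [Group N''] {D : ℕ → Subgroup N}
    {D' : ℕ → Subgroup N'} {D'' : ℕ → Subgroup N''} {f : N →* N'} {f' : N' →* N''}
    (h' : NExt D' D'' f') (h : NExt D D' f) : NExt D D'' (f'.comp f) := fun k hk a => by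
  rw [h k hk, h' k hk]; rfl

theorem root_list (w : ℕ) : ∀ {N : Type} [Group N] {D : ℕ → Subgroup N} (_ : NSer D)
    {x : N} (_ : x ∈ D (w + 1)), ∃ (N' : Type) (_ : Group N') (D' : ℕ → Subgroup N') (f : N →* N')
      (zs : List N'), NSer D' ∧ NExt D D' f ∧ zs.length = w + 1 ∧ leftComm zs = f x := by
  induction w with
  | zero =>
    intro N _ D h x hx
    exact ⟨N, _, D, MonoidHom.id N, [x], h, fun k _ a => Iff.rfl, rfl, rfl⟩
  | succ w ih =>
    intro N _ D h x hx
    obtain ⟨N1, _, D1, f1, u, t, h1, e1, hu, hut⟩ := root_adjoin h (by omega) hx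
    obtain ⟨N2, _, D2, f2, zs, h2, e2, hl, hz⟩ := ih h1 (x := u) (by simpa using hu)
    refine ⟨N2, inferInstance, D2, f2.comp f1, zs ++ [f2 t], h2, e2.comp e1, by simp [hl], ?_⟩
    rw [leftComm_append _ (by rintro rfl; simp at hl), hz, ← map_commutatorElement, hut]
    rfl

theorem root_family : ∀ (K : ℕ) {N : Type} [Group N] {D : ℕ → Subgroup N} (_ : NSer D)
    (L : List (N × ℕ)) (_ : L.length = K) (_ : ∀ q ∈ L, 1 ≤ q.2 ∧ q.1 ∈ D q.2),
    ∃ (N' : Type) (_ : Group N') (D' : ℕ → Subgroup N') (f : N →* N'),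
      NSer D' ∧ NExt D D' f ∧ ∀ q ∈ L, ∃ zs : List N', zs.length = q.2 ∧ leftComm zs = f q.1 := by
  intro K
  induction K with
  | zero =>
    intro N _ D h L hL _
    rw [List.length_eq_zero_iff] at hL
    subst hL
    exact ⟨N, _, D, MonoidHom.id N, h, fun k _ a => Iff.rfl, by simp⟩
  | succ K ih =>
    intro N _ D h L hL hq
    obtain ⟨q, L, rfl⟩ : ∃ q L', L = q :: L' := by
      cases L with
      | nil => simp at hL
      | cons q L' => exact ⟨q, L', rfl⟩
    have hq0 := hq q (by simp)
    obtain ⟨w, hw⟩ : ∃ w, q.2 = w + 1 := ⟨q.2 - 1, by omega⟩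
    obtain ⟨N1, _, D1, f1, zs, h1, e1, hl, hz⟩ := root_list w h (x := q.1) (by rw [← hw]; exact hq0.2)
    obtain ⟨N2, _, D2, f2, h2, e2, hL2⟩ := ih h1 (L.map fun r => (f1 r.1, r.2))
      (by simpa using hL) (by
        intro r hr
        rw [List.mem_map] at hr
        obtain ⟨r', hr', rfl⟩ := hr
        have := hq r' (by simp [hr'])
        exact ⟨this.1, (e1 _ this.1 _).1 this.2⟩)
    refine ⟨N2, inferInstance, D2, f2.comp f1, h2, e2.comp e1, ?_⟩
    intro r hr
    rw [List.mem_cons] at hr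
    rcases hr with rfl | hr
    · refine ⟨zs.map f2, by simp [hl, hw], ?_⟩
      rw [← leftComm_map, hz]; rfl
    · obtain ⟨zs', hz1, hz2⟩ := hL2 (f1 r.1, r.2) (List.mem_map.2 ⟨r, hr, rfl⟩)
      exact ⟨zs', hz1, hz2⟩

open scoped commutatorElement

/-- left-normed ring commutator -/
def lbr {S : Type*} [Ring S] : List S → S
  | [] => 0
  | a :: l => l.foldl (fun x y => x * y - y * x) a

theorem lbr_append {S : Type*} [Ring S] (l : List S) (h : l ≠ []) (a : S) :
    lbr (l ++ [a]) = lbr l * a - a * lbr l := by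
  cases l with
  | nil => exact absurd rfl h
  | cons b l => simp [lbr]

structure Filt {S : Type*} [Ring S] (J : ℕ → AddSubgroup S) : Prop where
  one : (1 : S) ∈ J 0
  anti : ∀ i j, i ≤ j → J j ≤ J i
  mul : ∀ i j a b, a ∈ J i → b ∈ J j → a * b ∈ J (i + j)

def Lead {S : Type*} [Ring S] (J : ℕ → AddSubgroup S) (u : Sˣ) (d : ℕ) (α : S) : Prop :=
  (u⁻¹.val ∈ J 0) ∧ α ∈ J d ∧ u.val - 1 - α ∈ J (d + 1)

section
variable {S : Type*} [Ring S] {J : ℕ → AddSubgroup S}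

theorem Lead.sub_one (F : Filt J) {u : Sˣ} {d : ℕ} {α : S} (h : Lead J u d α) :
    u.val - 1 ∈ J d := by
  have := add_mem (F.anti d (d + 1) (by omega) h.2.2) h.2.1
  simpa using this

theorem Lead.val0 (F : Filt J) {u : Sˣ} {d : ℕ} {α : S} (h : Lead J u d α) :
    u.val ∈ J 0 := by
  have := add_mem (F.anti 0 d (by omega) (h.sub_one F)) F.one
  simpa using this

theorem Lead.congr {u : Sˣ} {d : ℕ} {α β : S} (h : Lead J u d α) (e : α = β) :
    Lead J u d β := e ▸ h

theorem Lead.one (F : Filt J) (d : ℕ) : Lead J 1 d 0 :=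
  ⟨by simpa using F.one, zero_mem _, by simp [zero_mem]⟩

theorem Lead.mul (F : Filt J) {u v : Sˣ} {d : ℕ} (hd : 1 ≤ d) {α β : S} (hu : Lead J u d α)
    (hv : Lead J v d β) : Lead J (u * v) d (α + β) := by
  refine ⟨?_, add_mem hu.2.1 hv.2.1, ?_⟩
  · rw [mul_inv_rev, Units.val_mul]; exact F.mul 0 0 _ _ hv.1 hu.1
  · have e : (u * v).val - 1 - (α + β) = (u.val - 1 - α) + (v.val - 1 - β) +
        (u.val - 1) * (v.val - 1) := by rw [Units.val_mul]; noncomm_ring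
    rw [e]
    exact add_mem (add_mem hu.2.2 hv.2.2) (F.anti (d + 1) (d + d) (by omega)
      (F.mul d d _ _ (hu.sub_one F) (hv.sub_one F)))

theorem Lead.inv_sub_one (F : Filt J) {u : Sˣ} {d : ℕ} {α : S} (h : Lead J u d α) :
    u⁻¹.val - 1 ∈ J d := by
  have e : u⁻¹.val - 1 = -(u⁻¹.val * (u.val - 1)) := by rw [mul_sub]; simp
  rw [e]
  exact neg_mem (by simpa using F.mul 0 d _ _ h.1 (h.sub_one F))

theorem Lead.inv (F : Filt J) {u : Sˣ} {d : ℕ} (hd : 1 ≤ d) {α : S} (hu : Lead J u d α) :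
    Lead J u⁻¹ d (-α) := by
  refine ⟨by simpa using hu.val0 F, neg_mem hu.2.1, ?_⟩
  have e : u⁻¹.val - 1 - -α = -((u.val - 1 - α) * u⁻¹.val) - α * (u⁻¹.val - 1) := by
    rw [sub_mul, sub_mul]; simp; noncomm_ring
  rw [e]
  refine sub_mem (neg_mem (by simpa using F.mul _ 0 _ _ hu.2.2 hu.1)) ?_
  exact F.anti (d + 1) (d + d) (by omega) (F.mul _ _ _ _ hu.2.1 (hu.inv_sub_one F))

theorem Lead.pow (F : Filt J) {u : Sˣ} {d : ℕ} (hd : 1 ≤ d) {α : S} (hu : Lead J u d α) (k : ℕ) :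
    Lead J (u ^ k) d (k • α) := by
  induction k with
  | zero => simpa using Lead.one F d
  | succ k ih => rw [pow_succ, add_smul, one_smul]; exact ih.mul F hd hu

theorem Lead.zpow (F : Filt J) {u : Sˣ} {d : ℕ} (hd : 1 ≤ d) {α : S} (hu : Lead J u d α) (k : ℤ) :
    Lead J (u ^ k) d (k • α) := by
  cases k with
  | ofNat n => simpa using hu.pow F hd n
  | negSucc n =>
    rw [zpow_negSucc, negSucc_zsmul]
    exact (hu.pow F hd _).inv F hd

theorem Lead.comm (F : Filt J) {u v : Sˣ} {d e : ℕ} (hd : 1 ≤ d) (he : 1 ≤ e) {α β : S}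
    (hu : Lead J u d α) (hv : Lead J v e β) : Lead J ⁅u, v⁆ (d + e) (α * β - β * α) := by
  have m1 : α * β - β * α ∈ J (d + e) := sub_mem (F.mul _ _ _ _ hu.2.1 hv.2.1)
    (by rw [add_comm]; exact F.mul _ _ _ _ hv.2.1 hu.2.1)
  have q0 : u⁻¹.val * v⁻¹.val ∈ J 0 := F.mul 0 0 _ _ hu.1 hv.1
  refine ⟨?_, m1, ?_⟩
  · rw [commutatorElement_inv, commutatorElement_def, Units.val_mul, Units.val_mul, Units.val_mul,
      mul_assoc]
    refine F.mul 0 0 _ _ (F.mul 0 0 _ _ (hv.val0 F) (hu.val0 F)) (F.mul 0 0 _ _ hv.1 hu.1)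
  · have key : (⁅u, v⁆ : Sˣ).val - 1 - (α * β - β * α) =
        (((u.val - 1 - α) * (v.val - 1) + α * (v.val - 1 - β)) -
          ((v.val - 1 - β) * (u.val - 1) + β * (u.val - 1 - α))) * (u⁻¹.val * v⁻¹.val)
        + (α * β - β * α) * ((u⁻¹.val - 1) * v⁻¹.val + (v⁻¹.val - 1)) := by
      have e1 : (⁅u, v⁆ : Sˣ).val = u.val * v.val * (u⁻¹.val * v⁻¹.val) := by
        rw [commutatorElement_def]; simp [mul_assoc]
      have e2 : v.val * u.val * (u⁻¹.val * v⁻¹.val) = 1 := by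
        rw [mul_assoc, ← mul_assoc u.val]; simp
      have e3 : ((u.val - 1 - α) * (v.val - 1) + α * (v.val - 1 - β)) -
          ((v.val - 1 - β) * (u.val - 1) + β * (u.val - 1 - α)) =
          u.val * v.val - v.val * u.val - (α * β - β * α) := by noncomm_ring
      rw [e3, sub_mul, sub_mul, e2, e1]
      noncomm_ring
    rw [key]
    have a1 := hu.sub_one F
    have b1 := hv.sub_one F
    refine add_mem ?_ ?_
    · have := F.mul (d + e + 1) 0 _ _ (sub_mem (add_mem
        (F.anti (d + e + 1) (d + 1 + e) (by omega) (F.mul _ _ _ _ hu.2.2 b1))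
        (F.anti (d + e + 1) (d + (e + 1)) (by omega) (F.mul _ _ _ _ hu.2.1 hv.2.2)))
        (add_mem (F.anti (d + e + 1) (e + 1 + d) (by omega) (F.mul _ _ _ _ hv.2.2 a1))
        (F.anti (d + e + 1) (e + (d + 1)) (by omega) (F.mul _ _ _ _ hv.2.1 hu.2.2)))) q0
      simpa using this
    · refine F.mul _ 1 _ _ m1 (add_mem ?_ ?_)
      · exact F.anti 1 (d + 0) (by omega) (F.mul _ _ _ _ (hu.inv_sub_one F) hv.1)
      · exact F.anti 1 e (by omega) (hv.inv_sub_one F)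

theorem Lead.leftComm (F : Filt J) {ι : Type*} (u : ι → Sˣ) (X : ι → S)
    (h : ∀ i, Lead J (u i) 1 (X i)) (l : List ι) (hl : l ≠ []) :
    Lead J (leftComm (l.map u)) l.length (lbr (l.map X)) := by
  induction l using List.reverseRecOn with
  | nil => exact absurd rfl hl
  | append_singleton l a ih =>
    by_cases hn : l = []
    · subst hn; simpa [_root_.leftComm, lbr] using h a
    · rw [List.map_append, List.map_append, List.map_singleton, List.map_singleton,
        leftComm_append _ (by simpa using hn), lbr_append _ (by simpa using hn)]
      have := (ih hn).comm F (by rw [Nat.one_le_iff_ne_zero]; simpa using hn) le_rfl (h a)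
      simpa using this

theorem Lead.listProd (F : Filt J) {ι : Type*} {d : ℕ} (hd : 1 ≤ d) (u : ι → Sˣ) (X : ι → S)
    (l : List ι) (h : ∀ i ∈ l, Lead J (u i) d (X i)) :
    Lead J (l.map u).prod d (l.map X).sum := by
  induction l with
  | nil => simpa using Lead.one F d
  | cons a l ih =>
    simp only [List.map_cons, List.prod_cons, List.sum_cons]
    exact (h a (by simp)).mul F hd (ih fun i hi => h i (by simp [hi]))
end

/-- sign restricted to permutations fixing the first point -/
def sg0 {m : ℕ} [NeZero m] (τ : Equiv.Perm (Fin m)) : ℤ :=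
  if τ 0 = 0 then (Equiv.Perm.sign τ : ℤ) else 0

noncomputable def gElt {G : Type*} [Group G] {m : ℕ} [NeZero m] (q : ℤ) (x : Fin m → G) : G :=
  ((Finset.univ : Finset (Equiv.Perm (Fin m))).toList.map fun τ =>
    (leftComm (List.ofFn fun k => x (τ k))) ^ (sg0 τ * q)).prod

def lam {S : Type*} [Ring S] {m : ℕ} [NeZero m] (X : Fin m → S) : S :=
  ∑ τ : Equiv.Perm (Fin m), sg0 τ • lbr (List.ofFn fun k => X (τ k))

theorem gElt_map {G H : Type*} [Group G] [Group H] {m : ℕ} [NeZero m] (q : ℤ) (x : Fin m → G)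
    (f : G →* H) : f (gElt q x) = gElt q (fun i => f (x i)) := by
  unfold gElt
  rw [map_list_prod, List.map_map]
  congr 1
  apply List.map_congr_left
  intro τ _
  simp only [Function.comp_apply, map_zpow, leftComm_map, List.map_ofFn]
  rfl

theorem Lead.gElt {S : Type*} [Ring S] {J : ℕ → AddSubgroup S} (F : Filt J) {m : ℕ} [NeZero m]
    (q : ℤ) (u : Fin m → Sˣ) (X : Fin m → S) (h : ∀ i, Lead J (u i) 1 (X i)) :
    Lead J (gElt q u) m (q • lam X) := by
  have hm : 1 ≤ m := Nat.one_le_iff_ne_zero.2 (NeZero.ne m)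
  have e : q • lam X = ((Finset.univ : Finset (Equiv.Perm (Fin m))).toList.map fun τ =>
      (sg0 τ * q) • lbr (List.ofFn fun k => X (τ k))).sum := by
    rw [Finset.sum_map_toList, lam, Finset.smul_sum]
    refine Finset.sum_congr rfl fun τ _ => ?_
    rw [smul_smul, mul_comm]
  rw [e]
  refine Lead.listProd F hm _ _ _ fun τ _ => ?_
  refine Lead.zpow F hm ?_ _
  have := Lead.leftComm F u X h (List.ofFn fun k => τ k) (by
    intro h0
    have := congrArg List.length h0
    simp at this; omega)
  simpa [List.map_ofFn, Function.comp_def] using this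

open scoped commutatorElement TensorProduct

section
variable (m : ℕ) (S : Type) [Ring S]

abbrev ExA : Type := ExteriorAlgebra ℤ (Fin m → ℤ)
abbrev ExS : Type := ExA m ⊗[ℤ] S

noncomputable def eps (i : Fin m) : ExA m := ExteriorAlgebra.ι ℤ (Pi.single i 1)

noncomputable def topF : ExA m →ₗ[ℤ] ℤ :=
  ExteriorAlgebra.liftAlternating
    (fun i => if h : i = m then
      h ▸ (Matrix.detRowAlternating : (Fin m → ℤ) [⋀^Fin m]→ₗ[ℤ] ℤ) else 0)

noncomputable def ExT : ExS m S →+ S :=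
  (TensorProduct.lid ℤ S).toAddEquiv.toAddMonoidHom.comp
    (TensorProduct.map (topF m) (LinearMap.id : S →ₗ[ℤ] S)).toAddMonoidHom

variable {m S}

theorem ExT_tmul (a : ExA m) (s : S) : ExT m S (a ⊗ₜ s) = topF m a • s := by
  exact TensorProduct.lid_tmul s _

/-- determinant attached to a word -/
noncomputable def wdet (w : Fin m → Fin m) : ℤ :=
  Matrix.det (fun k => (Pi.single (w k) 1 : Fin m → ℤ))

theorem topF_word (w : Fin m → Fin m) :
    topF m (List.ofFn fun k => eps m (w k)).prod = wdet w := by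
  have : (List.ofFn fun k => eps m (w k)).prod =
      ExteriorAlgebra.ιMulti ℤ m (fun k => (Pi.single (w k) 1 : Fin m → ℤ)) := by
    rw [ExteriorAlgebra.ιMulti_apply]; rfl
  rw [this, topF, ExteriorAlgebra.liftAlternating_apply_ιMulti]
  simp [wdet]
  rfl

theorem wdet_perm (τ : Equiv.Perm (Fin m)) : wdet (fun k => τ k) = Equiv.Perm.sign τ := by
  have := Matrix.det_permutation (R := ℤ) τ
  rw [wdet]
  simp only [Int.cast_id] at this
  rw [← this]
  congr 1
  ext i j
  simp [PEquiv.toMatrix_apply, Pi.single_apply, eq_comm]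

theorem wdet_not (w : Fin m → Fin m) (h : w ∉ Set.range (fun τ : Equiv.Perm (Fin m) => (τ : Fin m → Fin m))) :
    wdet w = 0 := by
  by_cases hw : Function.Injective w
  · exfalso
    exact h ⟨Equiv.ofBijective w (Finite.injective_iff_bijective.1 hw), rfl⟩
  · rw [Function.not_injective_iff] at hw
    obtain ⟨i, j, hij, hne⟩ := hw
    exact Matrix.det_zero_of_row_eq hne (by rw [hij])

theorem sum_perm_eq {M : Type*} [AddCommGroup M] (F : (Fin m → Fin m) → M) :
    ∑ τ : Equiv.Perm (Fin m), (Equiv.Perm.sign τ : ℤ) • F (fun k => τ k) =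
      ∑ w : Fin m → Fin m, wdet w • F w := by
  refine Fintype.sum_of_injective (fun τ : Equiv.Perm (Fin m) => (τ : Fin m → Fin m))
    DFunLike.coe_injective _ _ ?_ ?_
  · intro w hw
    rw [wdet_not w hw, zero_smul]
  · intro τ
    rw [← wdet_perm]

noncomputable def xi (X : Fin m → S) (i : Fin m) : ExS m S := eps m i ⊗ₜ X i

theorem xi_prod (X : Fin m → S) (l : List (Fin m)) : (l.map (xi X)).prod =
    (l.map (eps m)).prod ⊗ₜ[ℤ] (l.map X).prod := by
  induction l with
  | nil => simp [Algebra.TensorProduct.one_def]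
  | cons a l ih => simp [ih, xi]

theorem ExT_prod (X : Fin m → S) (c : Fin m → Fin m → ℤ) :
    ExT m S (List.ofFn fun k => ∑ i, c k i • xi X i).prod =
      ∑ τ : Equiv.Perm (Fin m), (∏ k, c k (τ k)) • (Equiv.Perm.sign τ : ℤ) •
        (List.ofFn fun k => X (τ k)).prod := by
  have e1 : ∀ τ : Equiv.Perm (Fin m), (∏ k, c k (τ k)) • (Equiv.Perm.sign τ : ℤ) •
        (List.ofFn fun k => X (τ k)).prod = (Equiv.Perm.sign τ : ℤ) •
        (fun w : Fin m → Fin m => (∏ k, c k (w k)) • (List.ofFn fun k => X (w k)).prod)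
          (fun k => τ k) := by
    intro τ
    exact smul_comm _ _ _
  simp_rw [e1]
  rw [sum_perm_eq (fun w : Fin m → Fin m => (∏ k, c k (w k)) • (List.ofFn fun k => X (w k)).prod)]
  rw [← MultilinearMap.mkPiAlgebraFin_apply (R := ℤ), MultilinearMap.map_sum, map_sum]
  refine Finset.sum_congr rfl fun w _ => ?_
  rw [MultilinearMap.map_smul_univ, MultilinearMap.mkPiAlgebraFin_apply, map_zsmul]
  have : (List.ofFn fun k => xi X (w k)) = (List.ofFn w).map (xi X) := by
    rw [List.map_ofFn]; rfl
  rw [this, xi_prod, ExT_tmul, List.map_ofFn, List.map_ofFn]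
  have h2 := topF_word w
  simp only [Function.comp_def] at h2 ⊢
  rw [h2, smul_comm]

end

open scoped commutatorElement TensorProduct

section
variable {m : ℕ} {S : Type} [Ring S]

theorem eps_swap (a : Fin m) (l : List (Fin m)) :
    eps m a * (l.map (eps m)).prod = (-1) ^ l.length * ((l.map (eps m)).prod * eps m a) := by
  induction l with
  | nil => simp
  | cons b l ih =>
    have h : eps m a * eps m b = - (eps m b * eps m a) := by
      rw [eq_neg_iff_add_eq_zero]
      exact ExteriorAlgebra.ι_add_mul_swap _ _
    have hc : Commute ((-1 : ExA m) ^ l.length) (eps m b) :=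
      ((Commute.neg_one_left _).pow_left _)
    rw [List.map_cons, List.prod_cons, ← mul_assoc, h, neg_mul, mul_assoc, ih, ← mul_assoc,
      ← hc.eq, List.length_cons, pow_succ]
    simp [mul_assoc]

/-- sign-twisted bracket powers -/
noncomputable def Wseq {A : Type*} [Ring A] (Z x : A) : ℕ → A
  | 0 => Z
  | j + 1 => Wseq Z x j * x - (-1) ^ (j + 1) * (x * Wseq Z x j)

noncomputable def Eword (X : Fin m → S) (l : List (Fin m)) : ExS m S :=
  (l.map (eps m)).prod ⊗ₜ[ℤ] lbr (l.map X)

theorem Eword_step (X : Fin m → S) (l : List (Fin m)) (hl : l ≠ []) (a : Fin m) :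
    Eword X l * xi X a - (-1) ^ l.length * (xi X a * Eword X l) = Eword X (l ++ [a]) := by
  unfold Eword xi
  rw [Algebra.TensorProduct.tmul_mul_tmul, Algebra.TensorProduct.tmul_mul_tmul, eps_swap]
  have h1 : ((-1 : ExS m S)) ^ l.length = ((-1 : ExA m) ^ l.length) ⊗ₜ[ℤ] (1 : S) := by
    have : (-1 : ExS m S) = (-1 : ExA m) ⊗ₜ[ℤ] (1 : S) := by
      rw [TensorProduct.neg_tmul, Algebra.TensorProduct.one_def]
    rw [this, Algebra.TensorProduct.tmul_pow, one_pow]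
  have hh : (-1 : ExA m) ^ l.length * (-1 : ExA m) ^ l.length = 1 := by
    rw [← pow_add]; exact Even.neg_one_pow ⟨_, rfl⟩
  rw [h1, Algebra.TensorProduct.tmul_mul_tmul, ← mul_assoc, hh, one_mul, one_mul]
  rw [← TensorProduct.tmul_sub, List.map_append, List.map_append, List.prod_append,
    List.map_singleton, List.map_singleton, List.prod_singleton, lbr_append _ (by simpa using hl)]

theorem Wseq_eq [NeZero m] (X : Fin m → S) (j : ℕ) : Wseq (xi X 0) (∑ i, xi X i) j =
    ∑ f : Fin j → Fin m, Eword X (0 :: List.ofFn f) := by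
  induction j with
  | zero =>
    simp [Wseq, Eword, xi, lbr]
  | succ j ih =>
    rw [Wseq, ih, ← (Fin.snocEquiv (fun _ : Fin (j + 1) => Fin m)).sum_comp, Fintype.sum_prod_type_right,
      Finset.sum_mul, Finset.mul_sum, Finset.mul_sum, ← Finset.sum_sub_distrib]
    refine Finset.sum_congr rfl fun f _ => ?_
    rw [Finset.mul_sum, Finset.sum_mul, Finset.mul_sum, ← Finset.sum_sub_distrib]
    refine Finset.sum_congr rfl fun a _ => ?_
    have := Eword_step X (0 :: List.ofFn f) (by simp) a
    rw [List.length_cons, List.length_ofFn] at this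
    rw [this, List.ofFn_succ']
    simp [Fin.snocEquiv, List.concat_eq_append]

theorem ExT_Eword (X : Fin m → S) (w : Fin m → Fin m) : ExT m S (Eword X (List.ofFn w)) =
    wdet w • lbr (List.ofFn fun k => X (w k)) := by
  unfold Eword
  rw [ExT_tmul, List.map_ofFn, List.map_ofFn]
  have h2 := topF_word w
  simp only [Function.comp_def] at h2 ⊢
  rw [h2]

theorem ExT_Wseq [NeZero m] (X : Fin m → S) :
    ExT m S (Wseq (xi X 0) (∑ i, xi X i) (m - 1)) = lam X := by
  obtain ⟨M, rfl⟩ : ∃ M, m = M + 1 := ⟨m - 1, by have := NeZero.ne m; omega⟩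
  rw [Wseq_eq, map_sum, Nat.add_sub_cancel]
  have e : lam X = ∑ τ : Equiv.Perm (Fin (M + 1)), (Equiv.Perm.sign τ : ℤ) •
      (fun w : Fin (M + 1) → Fin (M + 1) => if w 0 = 0 then lbr (List.ofFn fun k => X (w k)) else 0)
        (fun k => τ k) := by
    unfold lam sg0
    refine Finset.sum_congr rfl fun τ _ => ?_
    simp only
    split_ifs <;> simp
  rw [e, sum_perm_eq (fun w : Fin (M + 1) → Fin (M + 1) =>
    if w 0 = 0 then lbr (List.ofFn fun k => X (w k)) else 0),
    ← (Fin.consEquiv (fun _ : Fin (M + 1) => Fin (M + 1))).sum_comp, Fintype.sum_prod_type_right]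
  refine Finset.sum_congr rfl fun f _ => ?_
  rw [Finset.sum_eq_single 0]
  · have h0 : (0 :: List.ofFn f) = List.ofFn (Fin.cons 0 f : Fin (M + 1) → Fin (M + 1)) := by
      simp
    rw [h0, ExT_Eword]
    simp [Fin.consEquiv]
  · intro b _ hb
    simp [Fin.consEquiv, hb]
  · simp

theorem Wseq_odd {A : Type*} [Ring A] (Z x : A) (j : ℕ) :
    Wseq Z x (2 * j + 1) = Wseq Z x (2 * j) * x + x * Wseq Z x (2 * j) := by
  have e1 : (-1 : A) ^ (2 * j + 1) = -1 := Odd.neg_one_pow ⟨j, rfl⟩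
  rw [Wseq, e1]; noncomm_ring

theorem Wseq_even {A : Type*} [Ring A] (Z x : A) (j : ℕ) :
    Wseq Z x (2 * j) = ∑ i ∈ Finset.range (j + 1), ((-1 : ℤ) ^ i * (j.choose i : ℤ)) •
      ((x ^ 2) ^ i * Z * (x ^ 2) ^ (j - i)) := by
  have h1 : ∀ j, Wseq Z x (2 * (j + 1)) = Wseq Z x (2 * j) * x ^ 2 - x ^ 2 * Wseq Z x (2 * j) := by
    intro j
    have : 2 * (j + 1) = 2 * j + 1 + 1 := by ring
    rw [this, Wseq, Wseq]
    have e1 : (-1 : A) ^ (2 * j + 1) = -1 := Odd.neg_one_pow ⟨j, rfl⟩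
    have e2 : (-1 : A) ^ (2 * j + 1 + 1) = 1 := Even.neg_one_pow ⟨j + 1, by ring⟩
    rw [e1, e2]
    noncomm_ring
  have h2 : ∀ j, Wseq Z x (2 * j) =
      ((-LinearMap.mulLeft ℤ (x ^ 2) + LinearMap.mulRight ℤ (x ^ 2)) ^ j : Module.End ℤ A) Z := by
    intro j
    induction j with
    | zero => simp [Wseq]
    | succ j ih =>
      rw [h1, ih, pow_succ' (-LinearMap.mulLeft ℤ (x ^ 2) + LinearMap.mulRight ℤ (x ^ 2)), Module.End.mul_apply]
      simp only [LinearMap.add_apply, LinearMap.neg_apply, LinearMap.mulLeft_apply,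
        LinearMap.mulRight_apply]
      abel
  have hc : Commute (-LinearMap.mulLeft ℤ (x ^ 2) : Module.End ℤ A) (LinearMap.mulRight ℤ (x ^ 2)) :=
    (LinearMap.commute_mulLeft_right _ _).neg_left
  rw [h2, hc.add_pow, LinearMap.sum_apply]
  refine Finset.sum_congr rfl fun i _ => ?_
  rw [neg_pow, LinearMap.pow_mulLeft, LinearMap.pow_mulRight]
  rw [mul_smul, ← Nat.cast_comm, ← nsmul_eq_mul, LinearMap.smul_apply]
  rw [mul_assoc, Module.End.mul_apply, Module.End.mul_apply]
  simp only [LinearMap.mulLeft_apply, LinearMap.mulRight_apply]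
  rcases Nat.even_or_odd i with h | h
  · simp [h.neg_one_pow, mul_assoc]
  · simp [h.neg_one_pow, mul_assoc]

/-- alternating sums over permutations with `τ a = 0` -/
noncomputable def Qsum [NeZero m] (X : Fin m → S) (a : ℕ) : S :=
  ∑ τ : Equiv.Perm (Fin m), (if (τ⁻¹ 0).val = a then (Equiv.Perm.sign τ : ℤ) else 0) •
    (List.ofFn fun k => X (τ k)).prod

theorem ExT_pow [NeZero m] (X : Fin m → S) (a b : ℕ) (h : a + 1 + b = m) :
    ExT m S ((∑ i, xi X i) ^ a * xi X 0 * (∑ i, xi X i) ^ b) = Qsum X a := by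
  have e : (∑ i, xi X i) ^ a * xi X 0 * (∑ i, xi X i) ^ b =
      (List.ofFn fun k : Fin m => ∑ i, (if k.val = a then (if i = 0 then 1 else 0) else 1 : ℤ) •
        xi X i).prod := by
    have : (List.ofFn fun k : Fin m => ∑ i, (if k.val = a then (if i = 0 then 1 else 0) else 1 : ℤ) •
        xi X i) = List.replicate a (∑ i, xi X i) ++ xi X 0 :: List.replicate b (∑ i, xi X i) := by
      apply List.ext_getElem
      · simp; omega
      · intro k hk1 hk2
        rw [List.getElem_ofFn]
        by_cases h1 : k < a
        · rw [List.getElem_append_left (by simpa using h1)]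
          have : k ≠ a := by omega
          simp [this]
        · rw [List.getElem_append_right (by simpa using h1)]
          by_cases h2 : k = a
          · simp [h2]
          · obtain ⟨t, rfl⟩ : ∃ t, k = a + (t + 1) := ⟨k - a - 1, by omega⟩
            simp
    rw [this]
    simp [mul_assoc]
  rw [e, ExT_prod, Qsum]
  refine Finset.sum_congr rfl fun τ _ => ?_
  rw [smul_smul]
  congr 1
  have h1 : ∀ k : Fin m, (if k.val = a then (if τ k = 0 then 1 else 0) else 1 : ℤ) =
      if k.val = a ∧ τ k ≠ 0 then 0 else 1 := by
    intro k; split_ifs <;> simp_all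
  simp_rw [h1]
  split_ifs with h2
  · rw [Finset.prod_eq_one, one_mul]
    intro k _
    rw [if_neg]
    rintro ⟨h3, h4⟩
    apply h4
    rw [← h2] at h3
    rw [Fin.ext h3]; simp
  · rw [Finset.prod_eq_zero (i := ⟨a, by omega⟩) (Finset.mem_univ _), zero_mul]
    rw [if_pos]
    refine ⟨rfl, fun h3 => h2 ?_⟩
    rw [← h3]; simp

theorem choose_mod (p : ℕ) (hp : p.Prime) (i : ℕ) (hi : i < p) :
    ∃ d : ℤ, (-1) ^ i * ((p - 1).choose i : ℤ) = 1 + p * d := by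
  induction i with
  | zero => exact ⟨0, by simp⟩
  | succ i ih =>
    obtain ⟨d, hd⟩ := ih (by omega)
    obtain ⟨e, he⟩ := hp.dvd_choose_self (k := i + 1) (by omega) hi
    have h1 : p.choose (i + 1) = (p - 1).choose i + (p - 1).choose (i + 1) := by
      obtain ⟨q, rfl⟩ : ∃ q, p = q + 1 := ⟨p - 1, by omega⟩
      rw [Nat.choose_succ_succ]; simp
    have h2 : (((p - 1).choose (i + 1) : ℕ) : ℤ) = p * e - ((p - 1).choose i : ℕ) := by
      rw [eq_sub_iff_add_eq, add_comm]; exact_mod_cast h1 ▸ he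
    refine ⟨d + (-1) ^ (i + 1) * e, ?_⟩
    rw [h2, mul_sub, pow_succ]
    linear_combination hd

theorem lam_eq (p : ℕ) (hp : p.Prime) [NeZero (2 * p)] (X : Fin (2 * p) → S) :
    lam X = ∑ i ∈ Finset.range p, ((-1 : ℤ) ^ i * ((p - 1).choose i : ℤ)) •
      (Qsum X (2 * i) + Qsum X (2 * i + 1)) := by
  have h2 := hp.two_le
  rw [← ExT_Wseq]
  have : 2 * p - 1 = 2 * (p - 1) + 1 := by omega
  rw [this, Wseq_odd, Wseq_even, map_add, Finset.sum_mul, Finset.mul_sum, map_sum, map_sum,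
    ← Finset.sum_add_distrib]
  have e2 : p - 1 + 1 = p := by omega
  rw [e2]
  refine Finset.sum_congr rfl fun i hi => ?_
  rw [Finset.mem_range] at hi
  rw [smul_mul_assoc, mul_smul_comm, map_zsmul, map_zsmul, smul_add]
  congr 2
  · rw [← ExT_pow X (2 * i) (2 * (p - 1 - i) + 1) (by omega), mul_assoc, ← pow_mul, ← pow_mul,
      ← pow_succ]
  · rw [← ExT_pow X (2 * i + 1) (2 * (p - 1 - i)) (by omega), ← mul_assoc, ← mul_assoc, ← pow_mul,
      ← pow_mul, ← pow_succ']

noncomputable def Xw (X : Fin m → S) (τ : Equiv.Perm (Fin m)) : S :=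
  (List.ofFn fun k => X (τ k)).prod

theorem lam_identity (p : ℕ) (hp : p.Prime) [NeZero (2 * p)] :
    ∃ a : Equiv.Perm (Fin (2 * p)) → ℤ, ∀ (S : Type) [Ring S] (X : Fin (2 * p) → S),
      lam X = (p : ℤ) • ∑ τ, a τ • Xw X τ + ∑ τ, (Equiv.Perm.sign τ : ℤ) • Xw X τ := by
  have h2 := hp.two_le
  choose! d hd using fun i hi => choose_mod p hp i hi
  refine ⟨fun τ => Equiv.Perm.sign τ * d ((τ⁻¹ 0).val / 2), ?_⟩
  intro S _ X
  rw [lam_eq p hp, Finset.smul_sum, ← Finset.sum_add_distrib]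
  simp only [Qsum]
  simp_rw [← Finset.sum_add_distrib, Finset.smul_sum]
  rw [Finset.sum_comm]
  refine Finset.sum_congr rfl fun τ _ => ?_
  have hb : (τ⁻¹ 0).val < 2 * p := (τ⁻¹ 0).2
  generalize (τ⁻¹ 0).val = b at hb
  rw [Finset.sum_eq_single (b / 2)]
  · rw [hd _ (by omega)]
    change (1 + p * d (b / 2)) • (_ • Xw X τ + _ • Xw X τ) = _
    rw [← add_smul, smul_smul, smul_smul, ← add_smul]
    congr 1
    rcases Nat.even_or_odd' b with ⟨k, rfl | rfl⟩
    · have : 2 * k / 2 = k := by omega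
      rw [this]
      simp; ring
    · have : (2 * k + 1) / 2 = k := by omega
      rw [this]
      simp; ring
  · intro i _ hi
    rw [if_neg (by omega), if_neg (by omega)]
    simp
  · intro h
    rw [Finset.mem_range] at h
    omega
end

open scoped commutatorElement TensorProduct

section
variable {m : ℕ} {S : Type} [Ring S]

noncomputable def Sgn (X : Fin m → S) : S := ∑ τ, (Equiv.Perm.sign τ : ℤ) • Xw X τ

theorem Sgn_eq_alt (X : Fin m → S) :
    Sgn X = MultilinearMap.alternatization (MultilinearMap.mkPiAlgebraFin ℤ m S) X := by
  rw [MultilinearMap.alternatization_apply]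
  refine Finset.sum_congr rfl fun τ _ => ?_
  rw [MultilinearMap.domDomCongr_apply, MultilinearMap.mkPiAlgebraFin_apply]
  rfl

theorem Sgn_update [NeZero m] (X : Fin m → S) :
    Sgn (Function.update X 0 (∑ i, X i)) = Sgn X := by
  rw [Sgn_eq_alt, Sgn_eq_alt, AlternatingMap.map_update_sum, Finset.sum_eq_single 0]
  · simp
  · intro b _ hb
    exact AlternatingMap.map_update_self _ _ hb.symm
  · simp

theorem Sgn_zero [NeZero m] (X : Fin m → S) (h : ∑ i, X i = 0) : Sgn X = 0 := by
  rw [← Sgn_update, h, Sgn_eq_alt]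
  exact AlternatingMap.map_update_zero _ _ _

theorem Sgn_ExT (X : Fin m → S) : Sgn X = ExT m S ((∑ i, xi X i) ^ m) := by
  have : (∑ i, xi X i) ^ m = (List.ofFn fun _ : Fin m => ∑ i, (1 : ℤ) • xi X i).prod := by
    simp
  rw [this, ExT_prod]
  simp [Sgn, Xw]

theorem anti_comm {A : Type*} [Ring A] {U V : A} (hanti : U * V = - (V * U)) :
    Commute (U ^ 2) (V ^ 2) := by
  have : Commute (U ^ 2) V := by
    rw [commute_iff_eq, sq, mul_assoc, hanti, mul_neg, ← mul_assoc, hanti, neg_mul, neg_neg,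
      mul_assoc]
  exact this.pow_right 2

/-- If the first two letters commute with the others, only the term `p U² V^(2p-2)` survives. -/
theorem Sgn_split (p : ℕ) (hp : p.Prime) (X : Fin (2 * p) → S)
    (hX : ∀ i j, i.val < 2 → 2 ≤ j.val → X i * X j = X j * X i) :
    Sgn X = (p : ℤ) • ∑ τ : Equiv.Perm (Fin (2 * p)),
      (if ∀ k, (k.val < 2 ↔ (τ k).val < 2) then (Equiv.Perm.sign τ : ℤ) else 0) • Xw X τ := by
  have hp2 := hp.two_le
  let U : ExS (2 * p) S := ∑ i, (if i.val < 2 then 1 else 0 : ℤ) • xi X i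
  let V : ExS (2 * p) S := ∑ i, (if i.val < 2 then 0 else 1 : ℤ) • xi X i
  have hUV : ∑ i, xi X i = U + V := by
    simp only [U, V, ← Finset.sum_add_distrib, ← add_smul]
    refine Finset.sum_congr rfl fun i _ => ?_
    split_ifs <;> simp
  have hanti : U * V = - (V * U) := by
    simp only [U, V, Finset.sum_mul, Finset.mul_sum, ← Finset.sum_neg_distrib]
    rw [Finset.sum_comm]
    refine Finset.sum_congr rfl fun i _ => Finset.sum_congr rfl fun j _ => ?_
    by_cases hi : i.val < 2
    · by_cases hj : j.val < 2
      · rw [if_pos hj, zero_smul, mul_zero, zero_mul, neg_zero]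
      · rw [if_pos hi, if_neg hj, one_smul, one_smul]
        rw [xi, xi, Algebra.TensorProduct.tmul_mul_tmul, Algebra.TensorProduct.tmul_mul_tmul,
          ← TensorProduct.neg_tmul, hX i j hi (by omega)]
        congr 1
        rw [eq_neg_iff_add_eq_zero]
        exact ExteriorAlgebra.ι_add_mul_swap _ _
    · rw [if_neg hi, zero_smul, mul_zero, zero_mul, neg_zero]
  have hc : Commute (U ^ 2) (V ^ 2) := anti_comm hanti
  have hsq : (U + V) ^ 2 = U ^ 2 + V ^ 2 := by
    rw [sq, add_mul, mul_add, mul_add, hanti, sq, sq]; abel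
  have hT : ∀ a b, a + b = 2 * p → ExT (2 * p) S (U ^ a * V ^ b) =
      ∑ τ : Equiv.Perm (Fin (2 * p)),
      (if ∀ k, (k.val < a ↔ (τ k).val < 2) then (Equiv.Perm.sign τ : ℤ) else 0) • Xw X τ := by
    intro a b hab
    have : U ^ a * V ^ b = (List.ofFn fun k : Fin (2 * p) => ∑ i : Fin (2 * p),
        (if (k.val < a ↔ i.val < 2) then 1 else 0 : ℤ) • xi X i).prod := by
      have : (List.ofFn fun k : Fin (2 * p) => ∑ i : Fin (2 * p),
        (if (k.val < a ↔ i.val < 2) then 1 else 0 : ℤ) • xi X i) =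
          List.replicate a U ++ List.replicate b V := by
        apply List.ext_getElem
        · simp; omega
        · intro k hk1 hk2
          rw [List.getElem_ofFn]
          by_cases h1 : k < a
          · rw [List.getElem_append_left (by simpa using h1)]
            simp [h1, U]
          · rw [List.getElem_append_right (by simpa using h1)]
            simp only [h1, false_iff, ite_not, List.getElem_replicate, V]
      rw [this]
      simp
    rw [this, ExT_prod]
    refine Finset.sum_congr rfl fun τ _ => ?_
    rw [smul_smul, Xw]
    congr 1
    split_ifs with h
    · rw [Finset.prod_eq_one (fun k _ => if_pos (h k)), one_mul]
    · rw [not_forall] at h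
      obtain ⟨k, hk⟩ := h
      rw [Finset.prod_eq_zero (i := k) (Finset.mem_univ _) (if_neg hk), zero_mul]
  rw [Sgn_ExT, hUV, pow_mul, hsq, hc.add_pow, map_sum, Finset.sum_eq_single 1]
  · rw [← pow_mul, ← pow_mul, Nat.choose_one_right, ← Nat.cast_comm, ← nsmul_eq_mul, map_nsmul,
      hT _ _ (by omega)]
    simp
  · intro i hi hi1
    rw [Finset.mem_range] at hi
    rw [← pow_mul, ← pow_mul, ← Nat.cast_comm, ← nsmul_eq_mul, map_nsmul, hT _ _ (by omega),
      Finset.sum_eq_zero, smul_zero]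
    intro τ _
    rw [if_neg, zero_smul]
    intro h
    by_cases h0 : i = 0
    · have := h (τ⁻¹ ⟨0, by omega⟩)
      simp [h0] at this
    · have a0 := (h ⟨0, by omega⟩).1 (by simp; omega)
      have a1 := (h ⟨1, by omega⟩).1 (by simp; omega)
      have a2 := (h ⟨2, by omega⟩).1 (by simp; omega)
      have n01 : (τ ⟨0, by omega⟩).val ≠ (τ ⟨1, by omega⟩).val := fun h => by
        have := τ.injective (Fin.ext h); simp at this
      have n02 : (τ ⟨0, by omega⟩).val ≠ (τ ⟨2, by omega⟩).val := fun h => by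
        have := τ.injective (Fin.ext h); simp at this
      have n12 : (τ ⟨1, by omega⟩).val ≠ (τ ⟨2, by omega⟩).val := fun h => by
        have := τ.injective (Fin.ext h); simp at this
      omega
  · intro h
    rw [Finset.mem_range] at h; omega

abbrev BM (m : ℕ) : Type := FreeMonoid (Fin m) × FreeMonoid (Fin m)
abbrev BA (m : ℕ) : Type := MonoidAlgebra ℤ (BM m)

def bgen (i : Fin m) : BM m := if i.val < 2 then (FreeMonoid.of i, 1) else (1, FreeMonoid.of i)

noncomputable def bX (i : Fin m) : BA m := MonoidAlgebra.of ℤ (BM m) (bgen i)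

noncomputable def bphi (m : ℕ) : BA m →+ ℤ :=
  (Finsupp.applyAddHom (List.ofFn fun k : Fin m => bgen k).prod).comp
    (MonoidAlgebra.coeffAddEquiv).toAddMonoidHom

theorem bX_comm (i j : Fin m) (hi : i.val < 2) (hj : 2 ≤ j.val) :
    (bX i : BA m) * bX j = bX j * bX i := by
  have : ¬ j.val < 2 := by omega
  rw [bX, bX, ← map_mul, ← map_mul, bgen, bgen, if_pos hi, if_neg this]
  simp

theorem bgen_prod (l : List (Fin m)) : (l.map bgen).prod =
    (FreeMonoid.ofList (l.filter (fun i => i.val < 2)),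
      FreeMonoid.ofList (l.filter (fun i => ¬ i.val < 2))) := by
  induction l with
  | nil => rfl
  | cons a l ih =>
    rw [List.map_cons, List.prod_cons, ih, bgen]
    by_cases h : a.val < 2
    · rw [if_pos h, List.filter_cons_of_pos (by simpa using h),
        List.filter_cons_of_neg (by simpa using h), Prod.mk_mul_mk, one_mul, FreeMonoid.ofList_cons]
    · rw [if_neg h, List.filter_cons_of_neg (by simpa using h),
        List.filter_cons_of_pos (by simpa using h), Prod.mk_mul_mk, one_mul, FreeMonoid.ofList_cons]

theorem filter_sorted {α : Type*} (q : α → Prop) [DecidablePred q] (l : List α)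
    (h : l.Pairwise (fun a b => q b → q a)) :
    l.filter q ++ l.filter (fun a => ¬ q a) = l := by
  induction l with
  | nil => rfl
  | cons a l ih =>
    rw [List.pairwise_cons] at h
    by_cases ha : q a
    · simp [ha]; simpa using ih h.2
    · have h1 : l.filter q = [] := by
        rw [List.filter_eq_nil_iff]; intro b hb hq; exact ha (h.1 b hb (by simpa using hq))
      have h2 := ih h.2
      rw [h1] at h2
      simp [ha, h1]
      simpa using h2

open Classical in
theorem bphi_Xw (τ : Equiv.Perm (Fin m)) : bphi m (Xw bX τ) =
    if (List.ofFn fun k : Fin m => bgen (τ k)).prod = (List.ofFn fun k : Fin m => bgen k).prod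
      then 1 else 0 := by
  have : Xw bX τ = MonoidAlgebra.of ℤ (BM m) (List.ofFn fun k : Fin m => bgen (τ k)).prod := by
    rw [map_list_prod, List.map_ofFn]; rfl
  rw [this]
  exact Finsupp.single_apply

open Classical in
theorem bphi_Sgn (p : ℕ) (hp : p.Prime) : bphi (2 * p) (Sgn bX) = p := by
  rw [Sgn_split p hp bX bX_comm, map_zsmul, map_sum, Finset.sum_eq_single 1]
  · simp [bphi_Xw]
  · intro τ _ hτ
    rw [map_zsmul]
    split_ifs with h
    · rw [bphi_Xw, if_neg, smul_zero]
      intro e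
      apply hτ
      have e1 : ∀ σ : Equiv.Perm (Fin (2 * p)), (List.ofFn fun k => bgen (σ k)) =
        (List.ofFn σ).map bgen := fun σ => by rw [List.map_ofFn]; rfl
      have e2 : (List.ofFn fun k : Fin (2 * p) => bgen k) =
        (List.ofFn (1 : Equiv.Perm (Fin (2 * p)))).map bgen := by rw [List.map_ofFn]; rfl
      rw [e1, e2, bgen_prod, bgen_prod, Prod.mk.injEq] at e
      have f1 := FreeMonoid.ofList.injective e.1
      have f2 := FreeMonoid.ofList.injective e.2
      have f3 : ∀ σ : Equiv.Perm (Fin (2 * p)), (∀ k, (k.val < 2 ↔ (σ k).val < 2)) →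
          (List.ofFn σ).filter (fun i => i.val < 2) ++ (List.ofFn σ).filter (fun i => ¬ i.val < 2)
            = List.ofFn σ := by
        intro σ hσ
        apply filter_sorted
        rw [List.pairwise_ofFn]
        intro i j hij hj
        rw [← hσ] at hj ⊢
        exact lt_trans hij hj
      have f4 := f3 τ h
      rw [f1, f2, f3 1 (by simp)] at f4
      exact DFunLike.coe_injective (List.ofFn_injective f4.symm)
    · simp
  · simp
end

open scoped commutatorElement

theorem three_sub {G : Type*} [Group G] (H₁ H₂ H₃ K : Subgroup G) [K.Normal]
    (h1 : ⁅⁅H₂, H₃⁆, H₁⁆ ≤ K) (h2 : ⁅⁅H₃, H₁⁆, H₂⁆ ≤ K) : ⁅⁅H₁, H₂⁆, H₃⁆ ≤ K := by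
  have key : ∀ H : Subgroup G, H ≤ K ↔ H.map (QuotientGroup.mk' K) = ⊥ := by
    intro H
    rw [Subgroup.map_eq_bot_iff, QuotientGroup.ker_mk']
  rw [key, Subgroup.map_commutator, Subgroup.map_commutator] at *
  exact Subgroup.commutator_commutator_eq_bot_of_rotate h1 h2

theorem lcs_comm {G : Type*} [Group G] (j : ℕ) : ∀ i : ℕ,
    ⁅(⊤ : Subgroup G).lowerCentralSeries i, (⊤ : Subgroup G).lowerCentralSeries j⁆ ≤
      (⊤ : Subgroup G).lowerCentralSeries (i + j + 1) := by
  induction j with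
  | zero => intro i; rw [Subgroup.lowerCentralSeries_zero, Nat.add_zero, Subgroup.lowerCentralSeries_succ]
  | succ j ih =>
    intro i
    rw [Subgroup.commutator_comm, Subgroup.lowerCentralSeries_succ]
    apply three_sub
    · rw [Subgroup.commutator_comm ⊤, ← Subgroup.lowerCentralSeries_succ]
      refine (ih (i + 1)).trans (le_of_eq ?_)
      congr 1; omega
    · refine (Subgroup.commutator_mono (ih i) le_rfl).trans (le_of_eq ?_)
      rw [← Subgroup.lowerCentralSeries_succ]
      congr 1

theorem gamma_NSer (G : Type) [Group G] : NSer (gammaGrp G) where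
  top := rfl
  anti := fun i j hi hij => Subgroup.lowerCentralSeries_antitone _ (by omega)
  comm := fun i j hi hj a ha b hb => by
    have := lcs_comm (j - 1) (i - 1) (Subgroup.commutator_mem_commutator ha hb)
    have e : i - 1 + (j - 1) + 1 = i + j - 1 := by omega
    rw [e] at this
    exact this

theorem NSer.normal {N : Type} [Group N] {D : ℕ → Subgroup N} (h : NSer D) (k : ℕ) (hk : 1 ≤ k) :
    (D k).Normal := ⟨fun a ha g => by
  have : g * a * g⁻¹ = ⁅g, a⁆ * a := by simp [commutatorElement_def]
  rw [this]
  exact mul_mem (h.anti k (1 + k) hk (by omega)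
    (h.comm 1 k le_rfl hk g (by simp [h.top]) a ha)) ha⟩

theorem comm_pow_left {G : Type*} [Group G] (a b : G) (h1 : Commute a ⁅a, b⁆) (u : ℕ) :
    ⁅a ^ u, b⁆ = ⁅a, b⁆ ^ u := by
  induction u with
  | zero => simp
  | succ u ih =>
    have : ⁅a ^ (u + 1), b⁆ = a * ⁅a ^ u, b⁆ * a⁻¹ * ⁅a, b⁆ := by
      simp only [commutatorElement_def, pow_succ']; group
    rw [this, ih, (h1.pow_right u).eq, mul_inv_cancel_right, pow_succ]

theorem comm_pow_pow {G : Type*} [Group G] (a b : G) (h1 : Commute a ⁅a, b⁆)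
    (h2 : Commute b ⁅a, b⁆) (u v : ℕ) : ⁅a ^ u, b ^ v⁆ = ⁅a, b⁆ ^ (u * v) := by
  have e : ⁅a ^ u, b⁆ = ⁅a, b⁆ ^ u := comm_pow_left a b h1 u
  have e1 : ⁅b, a ^ u⁆ = (⁅a, b⁆ ^ u)⁻¹ := by rw [← e, commutatorElement_inv]
  have e2 : Commute b ⁅b, a ^ u⁆ := by rw [e1]; exact (h2.pow_right u).inv_right
  rw [← commutatorElement_inv, comm_pow_left b (a ^ u) e2 v, e1, inv_pow, inv_inv, pow_mul]

theorem NSer.comm_pow {N : Type} [Group N] {D : ℕ → Subgroup N} (h : NSer D) {i j k : ℕ}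
    (hi : 1 ≤ i) (hj : 1 ≤ j) (hk : 1 ≤ k) (h1 : k ≤ 2 * i + j) (h2 : k ≤ i + 2 * j) {a b : N}
    (ha : a ∈ D i) (hb : b ∈ D j) (u v : ℕ) (huv : ⁅a ^ u, b ^ v⁆ ∈ D k) :
    ⁅a, b⁆ ^ (u * v) ∈ D k := by
  have := h.normal k hk
  have hab := h.comm i j hi hj a ha b hb
  have key : ∀ x : N, x ∈ D k ↔ QuotientGroup.mk' (D k) x = 1 := by
    intro x; rw [← MonoidHom.mem_ker, QuotientGroup.ker_mk']
  have c1 : ⁅a, ⁅a, b⁆⁆ ∈ D k := h.anti k (i + (i + j)) hk (by omega)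
    (h.comm _ _ hi (by omega) _ ha _ hab)
  have c2 : ⁅b, ⁅a, b⁆⁆ ∈ D k := h.anti k (j + (i + j)) hk (by omega)
    (h.comm _ _ hj (by omega) _ hb _ hab)
  rw [key] at huv c1 c2 ⊢
  simp only [map_commutatorElement, map_pow, commutatorElement_eq_one_iff_commute] at huv c1 c2 ⊢
  rw [← comm_pow_pow _ _ c1 c2]
  exact commutatorElement_eq_one_iff_commute.2 huv

theorem leftComm_pow_mem {G : Type} [Group G] {D : ℕ → Subgroup G} (h : NSer D) {ι : Type}
    (p ℓ : ℕ) (hl : 1 ≤ ℓ) (c : ι → ℕ) (x : ι → G) (hx : ∀ i, x i ∈ D ℓ)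
    (hy : ∀ i, x i ^ p ^ c i ∈ D (ℓ + c i)) (l : List ι) (hne : l ≠ []) (hs : (l.map c).sum ≤ ℓ) :
    leftComm (l.map x) ∈ D (l.length * ℓ) ∧
      leftComm (l.map x) ^ p ^ (l.map c).sum ∈ D (l.length * ℓ + (l.map c).sum) := by
  induction l using List.reverseRecOn with
  | nil => exact absurd rfl hne
  | append_singleton l a ih =>
    by_cases hn : l = []
    · subst hn
      simpa [leftComm] using And.intro (hx a) (hy a)
    · rw [List.map_append, List.sum_append, List.map_singleton, List.sum_singleton] at hs
      obtain ⟨i1, i2⟩ := ih hn (by omega)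
      have hlen : 1 ≤ l.length := by rw [Nat.one_le_iff_ne_zero]; simpa using hn
      have hlen2 : ℓ ≤ l.length * ℓ := Nat.le_mul_of_pos_left _ hlen
      rw [List.map_append, List.map_append, List.sum_append, List.map_singleton, List.map_singleton,
        List.sum_singleton, leftComm_append _ (by simpa using hn), List.length_append,
        List.length_singleton, add_mul, one_mul, pow_add]
      refine ⟨h.comm _ _ (by omega) hl _ i1 _ (hx a), ?_⟩
      refine h.comm_pow (i := l.length * ℓ) (j := ℓ) (by omega) hl (by omega) (by omega) (by omega)
        i1 (hx a) _ _ ?_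
      have := h.comm _ _ (by omega) (by omega) _ i2 _ (hy a)
      convert this using 2
      omega

theorem list_prod_pow_one {G : Type*} [Group G] (p : ℕ) (l : List G)
    (hc : ∀ a ∈ l, ∀ b ∈ l, Commute a b) (h : ∀ a ∈ l, a ^ p = 1) : l.prod ^ p = 1 := by
  induction l with
  | nil => simp
  | cons a l ih =>
    rw [List.prod_cons, Commute.mul_pow, h a (by simp), one_mul]
    · exact ih (fun a ha b hb => hc a (by simp [ha]) b (by simp [hb])) (fun a ha => h a (by simp [ha]))
    · exact Commute.list_prod_right _ _ fun b hb => hc a (by simp) b (by simp [hb])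

theorem gpow_mem {G : Type} [Group G] {D : ℕ → Subgroup G} (h : NSer D) {m : ℕ} [NeZero m]
    (p ℓ C : ℕ) (hl : 1 ≤ ℓ) (c : Fin m → ℕ) (hC : C = ∑ i, c i) (hC1 : 1 ≤ C) (hCl : C ≤ ℓ)
    (x : Fin m → G) (hx : ∀ i, x i ∈ D ℓ) (hy : ∀ i, x i ^ p ^ c i ∈ D (ℓ + c i)) :
    gElt ((p : ℤ) ^ (C - 1)) x ^ p ∈ D (m * ℓ + C) := by
  have hm : 1 ≤ m := Nat.one_le_iff_ne_zero.2 (NeZero.ne m)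
  have hml : ℓ ≤ m * ℓ := Nat.le_mul_of_pos_left _ hm
  have := h.normal (m * ℓ + C) (by omega)
  have key : ∀ x : G, x ∈ D (m * ℓ + C) ↔ QuotientGroup.mk' (D (m * ℓ + C)) x = 1 := by
    intro x; rw [← MonoidHom.mem_ker, QuotientGroup.ker_mk']
  have hb : ∀ τ : Equiv.Perm (Fin m), leftComm (List.ofFn fun k => x (τ k)) ∈ D (m * ℓ) ∧
      leftComm (List.ofFn fun k => x (τ k)) ^ p ^ C ∈ D (m * ℓ + C) := by
    intro τ
    have hs : ((List.ofFn τ).map c).sum = C := by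
      rw [List.map_ofFn, List.sum_ofFn, hC]
      exact Equiv.sum_comp τ c
    have := leftComm_pow_mem h p ℓ hl c x hx hy (List.ofFn τ) (by
      intro h0; have := congrArg List.length h0; simp at this; omega) (by omega)
    rw [hs, List.map_ofFn, List.length_ofFn] at this
    exact this
  rw [gElt, key, map_pow, map_list_prod, List.map_map]
  apply list_prod_pow_one
  · intro a ha b hb'
    rw [List.mem_map] at ha hb'
    obtain ⟨τ, -, rfl⟩ := ha
    obtain ⟨σ, -, rfl⟩ := hb'
    simp only [Function.comp_apply, map_zpow]
    apply Commute.zpow_zpow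
    rw [← commutatorElement_eq_one_iff_commute, ← map_commutatorElement, ← key]
    exact h.anti _ (m * ℓ + m * ℓ) (by omega) (by omega)
      (h.comm _ _ (by omega) (by omega) _ (hb τ).1 _ (hb σ).1)
  · intro a ha
    rw [List.mem_map] at ha
    obtain ⟨τ, -, rfl⟩ := ha
    simp only [Function.comp_apply]
    rw [← map_pow, ← key]
    have e : (leftComm (List.ofFn fun k => x (τ k)) ^ (sg0 τ * (p : ℤ) ^ (C - 1))) ^ p =
        (leftComm (List.ofFn fun k => x (τ k)) ^ p ^ C) ^ sg0 τ := by
      rw [← zpow_natCast, ← zpow_natCast, ← zpow_mul, ← zpow_mul]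
      congr 1
      obtain ⟨C', rfl⟩ : ∃ C', C = C' + 1 := ⟨C - 1, by omega⟩
      push_cast
      simp [pow_succ]; ring
    rw [e]
    exact zpow_mem (hb τ).2 _

open scoped commutatorElement

theorem Xw_mem {S : Type} [Ring S] {K : ℕ → AddSubgroup S} (F : Filt K) {m : ℕ}
    (Y : Fin m → S) (wt : Fin m → ℕ) (h : ∀ i, Y i ∈ K (wt i)) (τ : Equiv.Perm (Fin m)) :
    Xw Y τ ∈ K (∑ i, wt i) := by
  have key : ∀ l : List (Fin m), (l.map Y).prod ∈ K (l.map wt).sum := by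
    intro l
    induction l with
    | nil => simpa using F.one
    | cons a l ih => simpa using F.mul _ _ _ _ (h a) ih
  have h1 := key (List.ofFn fun k => τ k)
  rw [List.map_ofFn, List.map_ofFn, List.sum_ofFn] at h1
  have e : ∑ i, (wt ∘ fun k => τ k) i = ∑ i, wt i := Equiv.sum_comp τ wt
  rw [e] at h1
  exact h1

theorem Xw_smul {S : Type} [Ring S] {m : ℕ}
    (X : Fin m → S) (q : ℕ) (c : Fin m → ℕ) (τ : Equiv.Perm (Fin m)) :
    Xw (fun i => (q ^ c i) • X i) τ = (q ^ (∑ i, c i)) • Xw X τ := by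
  have key : ∀ l : List (Fin m), (l.map (fun i => (q ^ c i) • X i)).prod =
      (q ^ (l.map c).sum) • (l.map X).prod := by
    intro l
    induction l with
    | nil => simp
    | cons a l ih => simp only [List.map_cons, List.prod_cons, List.sum_cons, ih, smul_mul_smul_comm, pow_add]
  have h1 := key (List.ofFn fun k => τ k)
  rw [List.map_ofFn, List.map_ofFn, List.map_ofFn, List.sum_ofFn] at h1
  have e : ∑ i, (c ∘ fun k => τ k) i = ∑ i, c i := Equiv.sum_comp τ c
  rw [e] at h1
  exact h1

theorem filt_scale {S : Type} [Ring S] {K : ℕ → AddSubgroup S} (F : Filt K) (ℓ : ℕ) :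
    Filt (fun d => K (d * ℓ)) where
  one := by simpa using F.one
  anti := fun i j h => F.anti _ _ (Nat.mul_le_mul_right _ h)
  mul := fun i j a b ha hb => by
    have := F.mul _ _ a b ha hb
    simpa [Nat.add_mul] using this

theorem g_delta_ring (p : ℕ) (hp : p.Prime) [NeZero (2 * p)] {S : Type} [Ring S]
    {K : ℕ → AddSubgroup S} (F : Filt K) (ℓ C : ℕ) (c : Fin (2 * p) → ℕ)
    (hC : C = ∑ i, c i) (hC1 : 1 ≤ C) (hCl : C ≤ ℓ) (u : Fin (2 * p) → Sˣ)
    (hinv : ∀ i, (u i)⁻¹.val ∈ K 0)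
    (hx : ∀ i, (u i).val - 1 ∈ K ℓ) (hy : ∀ i, (u i ^ p ^ c i).val - 1 ∈ K (ℓ + c i))
    (hprod : (List.ofFn u).prod = 1) :
    (gElt ((p : ℤ) ^ (C - 1)) u).val - 1 ∈ K (2 * p * ℓ + C) := by
  have F' := filt_scale F ℓ
  set X : Fin (2 * p) → S := fun i => (u i).val - 1 with hX
  have hL : ∀ i, Lead (fun d => K (d * ℓ)) (u i) 1 (X i) := fun i =>
    ⟨by simpa using hinv i, by simpa using hx i, by simp [hX, zero_mem]⟩
  have hci : ∀ i, c i ≤ C := fun i => by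
    rw [hC]; exact Finset.single_le_sum (fun _ _ => Nat.zero_le _) (Finset.mem_univ i)
  have h1 := (Lead.gElt F' ((p : ℤ) ^ (C - 1)) u X hL).2.2
  have h1' : (gElt ((p : ℤ) ^ (C - 1)) u).val - 1 - ((p : ℤ) ^ (C - 1)) • lam X ∈ K (2 * p * ℓ + C) :=
    F.anti _ _ (by rw [Nat.add_mul, one_mul]; omega) h1
  have hpx : ∀ i, (p ^ c i) • X i ∈ K (ℓ + c i) := by
    intro i
    have h2 := ((hL i).pow F' le_rfl (p ^ c i)).2.2
    have h3 := F.anti (ℓ + c i) ((1 + 1) * ℓ) (by have := hci i; omega) h2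
    have := sub_mem (hy i) h3
    simpa using this
  have hsum : ∑ i, X i ∈ K (2 * ℓ) := by
    have h2 := (Lead.listProd F' le_rfl u X (List.ofFn id) (fun i _ => hL i)).2.2
    rw [List.map_ofFn, List.map_ofFn] at h2
    simp only [Function.comp_id] at h2
    rw [hprod, List.sum_ofFn] at h2
    simpa using h2
  have hsgn : Sgn X ∈ K (2 * p * ℓ + C) := by
    rw [← Sgn_update]
    refine sum_mem fun τ _ => zsmul_mem ?_ _
    have := Xw_mem F (Function.update X 0 (∑ i, X i)) (Function.update (fun _ => ℓ) 0 (2 * ℓ)) (by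
      intro i
      by_cases h : i = 0
      · subst h; simpa using hsum
      · simpa [Function.update_of_ne h] using hx i) τ
    refine F.anti _ _ ?_ this
    rw [Finset.sum_update_of_mem (Finset.mem_univ _)]
    simp only [Finset.sum_const, smul_eq_mul]
    rw [Finset.card_sdiff_of_subset (by simp)]
    simp only [Finset.card_univ, Fintype.card_fin, Finset.card_singleton]
    have h0 : 1 ≤ 2 * p := Nat.one_le_iff_ne_zero.2 (NeZero.ne _)
    obtain ⟨t, ht⟩ := Nat.exists_eq_add_of_le h0
    rw [ht]; simp only [Nat.add_sub_cancel_left]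
    ring_nf; omega
  obtain ⟨a, ha⟩ := lam_identity p hp
  have hlam : ((p : ℤ) ^ (C - 1)) • lam X ∈ K (2 * p * ℓ + C) := by
    rw [ha S X, smul_add, smul_smul, ← pow_succ, Nat.sub_add_cancel hC1]
    refine add_mem ?_ (zsmul_mem hsgn _)
    rw [Finset.smul_sum]
    refine sum_mem fun τ _ => ?_
    rw [smul_comm]
    refine zsmul_mem ?_ _
    have := Xw_mem F _ _ hpx τ
    rw [Xw_smul, ← hC, Finset.sum_add_distrib, ← hC] at this
    simp only [Finset.sum_const, Finset.card_univ, Fintype.card_fin, smul_eq_mul] at this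
    have e : ((p : ℤ) ^ C) • Xw X τ = (p ^ C) • Xw X τ := by
      rw [← natCast_zsmul]; push_cast; rfl
    rw [e]; exact this
  have := add_mem h1' hlam
  simpa using this

/-- the augmentation filtration -/
noncomputable def augK (G : Type) [Group G] (k : ℕ) : AddSubgroup (MonoidAlgebra ℤ G) :=
  if k = 0 then ⊤ else (augIdeal G ^ k).toAddSubgroup

theorem aug_left (G : Type) [Group G] (k : ℕ) (a b : MonoidAlgebra ℤ G)
    (hb : b ∈ augIdeal G ^ (k + 1)) : a * b ∈ augIdeal G ^ (k + 1) := by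
  have h : (⊤ : Submodule ℤ (MonoidAlgebra ℤ G)) * augIdeal G ^ (k + 1) ≤ augIdeal G ^ (k + 1) := by
    rw [pow_succ', ← mul_assoc]
    refine mul_le_mul' ?_ le_rfl
    rw [Submodule.mul_le]
    intro x _ y hy
    exact Ideal.mul_mem_left _ _ hy
  exact h (Submodule.mul_mem_mul trivial hb)

theorem aug_right (G : Type) [Group G] (k : ℕ) (a b : MonoidAlgebra ℤ G)
    (ha : a ∈ augIdeal G ^ (k + 1)) : a * b ∈ augIdeal G ^ (k + 1) := by
  have h : augIdeal G ^ (k + 1) * (⊤ : Submodule ℤ (MonoidAlgebra ℤ G)) ≤ augIdeal G ^ (k + 1) := by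
    rw [pow_succ, mul_assoc]
    refine mul_le_mul' le_rfl ?_
    rw [Submodule.mul_le]
    intro x hx y _
    have hx' : ((MonoidAlgebra.lift ℤ ℤ G) 1).toRingHom x = 0 := hx
    change ((MonoidAlgebra.lift ℤ ℤ G) 1).toRingHom (x * y) = 0
    rw [map_mul, hx', zero_mul]
  exact h (Submodule.mul_mem_mul ha trivial)

theorem mem_augK {G : Type} [Group G] {k : ℕ} (hk : k ≠ 0) {a : MonoidAlgebra ℤ G} :
    a ∈ augK G k ↔ a ∈ augIdeal G ^ k := by
  unfold augK; rw [if_neg hk]; rfl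

theorem augK_filt (G : Type) [Group G] : Filt (augK G) where
  one := by simp [augK]
  mul := by
    intro i j a b ha hb
    rcases i with _ | i
    · rcases j with _ | j
      · simp [augK]
      · rw [Nat.zero_add, mem_augK (by omega)]
        rw [mem_augK (by omega)] at hb
        exact aug_left G j a b hb
    · rcases j with _ | j
      · rw [Nat.add_zero, mem_augK (by omega)]
        rw [mem_augK (by omega)] at ha
        exact aug_right G i a b ha
      · rw [mem_augK (by omega)] at *
        rw [pow_add]
        exact Submodule.mul_mem_mul ha hb
  anti := by
    have h1 : ∀ i, augK G (i + 1) ≤ augK G i := by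
      intro i a ha
      rcases i with _ | i
      · simp [augK]
      · rw [mem_augK (by omega)] at *
        have h : augIdeal G ^ (i + 1) * augIdeal G ≤ augIdeal G ^ (i + 1) := by
          rw [Submodule.mul_le]
          intro x hx y _
          exact aug_right G i x y hx
        rw [pow_succ] at ha
        exact h ha
    exact fun i j h => antitone_nat_of_succ_le h1 h

noncomputable def gu (G : Type) [Group G] : G →* (MonoidAlgebra ℤ G)ˣ :=
  (Units.map (MonoidAlgebra.of ℤ G)).comp (toUnits (G := G)).toMonoidHom

theorem gu_val (G : Type) [Group G] (g : G) : (gu G g).val = MonoidAlgebra.of ℤ G g := rfl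

theorem gu_leftComm (G : Type) [Group G] (l : List G) (hl : l ≠ []) :
    (gu G (leftComm l)).val - 1 ∈ augK G l.length := by
  rw [leftComm_map]
  refine (Lead.leftComm (augK_filt G) (gu G) (fun g => (gu G g).val - 1) ?_ l hl).sub_one (augK_filt G)
  intro g
  refine ⟨by simp [augK], ?_, by simp [zero_mem]⟩
  rw [mem_augK (by omega), pow_one, gu_val]
  change ((MonoidAlgebra.lift ℤ ℤ G) 1).toRingHom _ = 0
  have e : ((MonoidAlgebra.lift ℤ ℤ G) 1).toRingHom (MonoidAlgebra.of ℤ G g) = 1 :=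
    MonoidAlgebra.lift_of _ _
  rw [RingHom.map_sub, e, RingHom.map_one, sub_self]

theorem leftComm_gamma {G : Type} [Group G] (l : List G) (hl : l ≠ []) :
    leftComm l ∈ gammaGrp G l.length := by
  induction l using List.reverseRecOn with
  | nil => exact absurd rfl hl
  | append_singleton l a ih =>
    by_cases h : l = []
    · subst h; simp [gammaGrp]
    · rw [leftComm_append l h]
      have := (gamma_NSer G).comm l.length 1 (List.length_pos_of_ne_nil h) le_rfl _ (ih h) a
        (by rw [(gamma_NSer G).top]; trivial)
      simpa using this

theorem g_delta (p : ℕ) (hp : p.Prime) [NeZero (2 * p)] {G : Type} [Group G]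
    (ℓ C : ℕ) (c : Fin (2 * p) → ℕ)
    (hC : C = ∑ i, c i) (hC1 : 1 ≤ C) (hCl : C ≤ ℓ) (x : Fin (2 * p) → G)
    (hx : ∀ i, ∃ l : List G, l.length = ℓ ∧ x i = leftComm l)
    (hy : ∀ i, ∃ l : List G, l.length = ℓ + c i ∧ x i ^ p ^ c i = leftComm l)
    (hprod : (List.ofFn x).prod = 1) :
    gElt ((p : ℤ) ^ (C - 1)) x ∈ dimensionSubgroup G (2 * p * ℓ + C) ∧
    gElt ((p : ℤ) ^ (C - 1)) x ^ p ∈ gammaGrp G (2 * p * ℓ + C) := by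
  have ne : ∀ (l : List G) k, l.length = k → 1 ≤ k → l ≠ [] := by
    intro l k h1 h2 h3; subst h3; simp at h1; omega
  constructor
  · have h := g_delta_ring p hp (augK_filt G) ℓ C c hC hC1 hCl (fun i => gu G (x i))
      (fun i => by simp [augK]) (fun i => by
        obtain ⟨l, h1, h2⟩ := hx i
        rw [h2, ← h1]; exact gu_leftComm G l (ne l _ h1 (by omega)))
      (fun i => by
        obtain ⟨l, h1, h2⟩ := hy i
        rw [← map_pow, h2, ← h1]; exact gu_leftComm G l (ne l _ h1 (by omega)))
      (by
        have := congrArg (gu G) hprod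
        rw [map_list_prod, List.map_ofFn, map_one] at this
        exact this)
    rw [← gElt_map, mem_augK (by omega), gu_val] at h
    exact h
  · exact gpow_mem (gamma_NSer G) p ℓ C (by omega) c hC hC1 hCl x (fun i => by
        obtain ⟨l, h1, h2⟩ := hx i
        rw [h2, ← h1]; exact leftComm_gamma l (ne l _ h1 (by omega)))
      (fun i => by
        obtain ⟨l, h1, h2⟩ := hy i
        rw [h2, ← h1]; exact leftComm_gamma l (ne l _ h1 (by omega)))

open scoped commutatorElement

def zn (L k : ℕ) : ℕ := (k - 1) / L + 1

theorem zn_mono (L : ℕ) {i j : ℕ} (h : i ≤ j) : zn L i ≤ zn L j := by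
  unfold zn
  exact Nat.succ_le_succ (Nat.div_le_div_right (by omega))

theorem zn_add (L : ℕ) (hL : 1 ≤ L) {i j : ℕ} (hi : 1 ≤ i) (hj : 1 ≤ j) :
    zn L (i + j) ≤ zn L i + zn L j := by
  unfold zn
  have h : (i + j - 1) / L < (i - 1) / L + (j - 1) / L + 2 := by
    rw [Nat.div_lt_iff_lt_mul hL]
    have h1 := Nat.lt_div_mul_add (a := i - 1) hL
    have h2 := Nat.lt_div_mul_add (a := j - 1) hL
    have e : ((i - 1) / L + (j - 1) / L + 2) * L =
      (i - 1) / L * L + (j - 1) / L * L + 2 * L := by ring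
    rw [e]
    omega
  omega

theorem zn_eq (L k d : ℕ) (h1 : d * L + 1 ≤ k) (h2 : k ≤ (d + 1) * L) : zn L k = d + 1 := by
  unfold zn
  rw [Nat.div_eq_of_lt_le (k := d)] <;> omega

structure LamSys {S : Type} [Ring S] (I : ℕ → AddSubgroup S) (Λ : ℕ → ℕ → AddSubgroup S) : Prop where
  filt : Filt I
  le : ∀ d k, Λ d k ≤ I d
  anti : ∀ d k k', k ≤ k' → Λ d k' ≤ Λ d k
  br : ∀ d e i j a b, a ∈ Λ d i → b ∈ Λ e j → a * b - b * a ∈ Λ (d + e) (i + j)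

section
variable {S : Type} [Ring S] {I : ℕ → AddSubgroup S} {Λ : ℕ → ℕ → AddSubgroup S}

def DS (h : LamSys I Λ) (L k : ℕ) : Subgroup Sˣ where
  carrier := {q | ∃ α ∈ Λ (zn L k) k, Lead I q (zn L k) α}
  one_mem' := ⟨0, zero_mem _, Lead.one h.filt _⟩
  mul_mem' := by
    rintro a b ⟨α, h1, h2⟩ ⟨β, h3, h4⟩
    exact ⟨α + β, add_mem h1 h3, h2.mul h.filt (by simp [zn]) h4⟩
  inv_mem' := by
    rintro a ⟨α, h1, h2⟩
    exact ⟨-α, neg_mem h1, h2.inv h.filt (by simp [zn])⟩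

theorem DS_drop (h : LamSys I Λ) (L k : ℕ) {q : Sˣ} {d : ℕ} {α : S} (h1 : Lead I q d α)
    (h2 : zn L k < d) : q ∈ DS h L k :=
  ⟨0, zero_mem _, h1.1, zero_mem _, by
    rw [sub_zero]; exact h.filt.anti _ _ (by omega) (h1.sub_one h.filt)⟩

theorem DS_anti (h : LamSys I Λ) (L : ℕ) {i j : ℕ} (hij : i ≤ j) : DS h L j ≤ DS h L i := by
  rintro q ⟨α, h1, h2⟩
  rcases (zn_mono L hij).eq_or_lt with e | e
  · exact ⟨α, by rw [e]; exact h.anti _ _ _ hij h1, by rw [e]; exact h2⟩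
  · exact DS_drop h L i h2 e

theorem DS_comm (h : LamSys I Λ) (L : ℕ) (hL : 1 ≤ L) {i j : ℕ} (hi : 1 ≤ i) (hj : 1 ≤ j) (a b : Sˣ)
    (ha : a ∈ DS h L i) (hb : b ∈ DS h L j) : ⁅a, b⁆ ∈ DS h L (i + j) := by
  obtain ⟨α, h1, h2⟩ := ha
  obtain ⟨β, h3, h4⟩ := hb
  have h5 := h2.comm h.filt (by simp [zn]) (by simp [zn]) h4
  rcases (zn_add L hL hi hj).eq_or_lt with e | e
  · exact ⟨_, by rw [e]; exact h.br _ _ _ _ _ _ h1 h3, by rw [e]; exact h5⟩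
  · exact DS_drop h L _ h5 e

theorem DS_NSer (h : LamSys I Λ) (L : ℕ) (hL : 1 ≤ L) :
    NSer (fun k => (DS h L k).subgroupOf (DS h L 1)) where
  top := Subgroup.subgroupOf_self _
  anti := fun _ _ _ hij _ ha => DS_anti h L hij ha
  comm := fun _ _ hi hj _ ha _ hb => DS_comm h L hL hi hj _ _ ha hb

end

theorem unit_of_nil {S : Type} [Ring S] {I : ℕ → AddSubgroup S} (F : Filt I) (x : S)
    (hx : x ∈ I 1) (M : ℕ) (h : x ^ M = 0) : ∃ u : Sˣ, Lead I u 1 x ∧ u.val = 1 + x := by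
  have e : (-x) ^ M = 0 := by rw [neg_pow, h, mul_zero]
  have h1 := mul_neg_geom_sum (-x) M
  have h2 := geom_sum_mul_neg (-x) M
  rw [e, sub_zero, sub_neg_eq_add] at h1 h2
  refine ⟨⟨1 + x, _, h1, h2⟩, ⟨?_, hx, by simp [zero_mem]⟩, rfl⟩
  change (∑ i ∈ Finset.range M, (-x) ^ i) ∈ I 0
  have key : ∀ i : ℕ, (-x) ^ i ∈ I 0 := fun i => by
   induction i with
   | zero => simpa using F.one
   | succ i ih => rw [pow_succ]; exact F.mul 0 0 _ _ ih (F.anti 0 1 (by omega) (neg_mem hx))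
  exact sum_mem fun i _ => key i

/-- brackets with content -/
inductive BR {ι S : Type} [Ring S] (g : ι → S) : Multiset ι → S → Prop
  | gen (i : ι) : BR g {i} (g i)
  | br {s t : Multiset ι} {a b : S} : BR g s a → BR g t b → BR g (s + t) (a * b - b * a)

section
variable {ι S : Type} [Ring S] {g : ι → S}

theorem BR.commute {s : Multiset ι} {a : S} (h : BR g s a) {T : Type} [Ring T] (f : S →+* T) (y : T)
    (hy : ∀ i ∈ s, Commute (f (g i)) y) : Commute (f a) y := by
  induction h with
  | gen i => exact hy i (by simp)
  | br _ _ ih1 ih2 =>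
    have h1 := ih1 fun i hi => hy i (by simp [hi])
    have h2 := ih2 fun i hi => hy i (by simp [hi])
    rw [map_sub, map_mul, map_mul]
    exact (h1.mul_left h2).sub_left (h2.mul_left h1)

theorem BR.mixed {T : Type} [Ring T] (f : S →+* T) (P : ι → Prop)
    (hc : ∀ i j, P i → ¬ P j → Commute (f (g i)) (f (g j))) {s : Multiset ι} {a : S} (h : BR g s a)
    (h1 : ∃ i ∈ s, P i) (h2 : ∃ i ∈ s, ¬ P i) : f a = 0 := by
  induction h with
  | gen i =>
    obtain ⟨j, hj, hj'⟩ := h1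
    obtain ⟨k, hk, hk'⟩ := h2
    rw [Multiset.mem_singleton] at hj hk
    subst hj; subst hk
    exact absurd hj' hk'
  | @br s t a b hs ht ih1 ih2 =>
    rw [map_sub, map_mul, map_mul, sub_eq_zero]
    change Commute (f a) (f b)
    by_cases hs1 : ∃ i ∈ s, P i
    · by_cases hs2 : ∃ i ∈ s, ¬ P i
      · rw [ih1 hs1 hs2]; exact Commute.zero_left _
      · by_cases ht1 : ∃ i ∈ t, P i
        · by_cases ht2 : ∃ i ∈ t, ¬ P i
          · rw [ih2 ht1 ht2]; exact Commute.zero_right _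
          · obtain ⟨k, hk, hk'⟩ := h2
            rcases Multiset.mem_add.1 hk with hk | hk
            · exact absurd ⟨k, hk, hk'⟩ hs2
            · exact absurd ⟨k, hk, hk'⟩ ht2
        · refine hs.commute f _ fun i hi => (ht.commute f _ fun j hj => ?_).symm
          push Not at hs2 ht1
          exact (hc i j (hs2 i hi) (ht1 j hj)).symm
    · by_cases ht2 : ∃ i ∈ t, ¬ P i
      · by_cases ht1 : ∃ i ∈ t, P i
        · rw [ih2 ht1 ht2]; exact Commute.zero_right _
        · obtain ⟨k, hk, hk'⟩ := h1
          rcases Multiset.mem_add.1 hk with hk | hk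
          · exact absurd ⟨k, hk, hk'⟩ hs1
          · exact absurd ⟨k, hk, hk'⟩ ht1
      · refine hs.commute f _ fun i hi => (ht.commute f _ fun j hj => ?_).symm
        push Not at hs1 ht2
        exact hc j i (ht2 j hj) (hs1 i hi)

theorem BR.span {s : Multiset ι} {a : S} (h : BR g s a) :
    a ∈ AddSubgroup.closure {b | ∃ l : List ι, (l : Multiset ι) = s ∧ b = (l.map g).prod} := by
  induction h with
  | gen i => exact AddSubgroup.subset_closure ⟨[i], by simp, by simp⟩
  | @br s t a b _ _ ih1 ih2 =>
    have key : ∀ (s t : Multiset ι) (a b : S),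
        a ∈ AddSubgroup.closure {b | ∃ l : List ι, (l : Multiset ι) = s ∧ b = (l.map g).prod} →
        b ∈ AddSubgroup.closure {b | ∃ l : List ι, (l : Multiset ι) = t ∧ b = (l.map g).prod} →
        a * b ∈ AddSubgroup.closure {b | ∃ l : List ι, (l : Multiset ι) = s + t ∧ b = (l.map g).prod} := by
      intro s t a b ha hb
      induction ha using AddSubgroup.closure_induction with
      | mem x hx =>
        obtain ⟨l, h1, rfl⟩ := hx
        induction hb using AddSubgroup.closure_induction with
        | mem y hy =>
          obtain ⟨l', h1', rfl⟩ := hy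
          exact AddSubgroup.subset_closure ⟨l ++ l', by rw [← Multiset.coe_add, h1, h1'], by simp⟩
        | zero => rw [mul_zero]; exact zero_mem _
        | add y z _ _ hy hz => rw [mul_add]; exact add_mem hy hz
        | neg y _ hy => rw [mul_neg]; exact neg_mem hy
      | zero => rw [zero_mul]; exact zero_mem _
      | add y z _ _ hy hz => rw [add_mul]; exact add_mem hy hz
      | neg y _ hy => rw [neg_mul]; exact neg_mem hy
    exact sub_mem (key s t a b ih1 ih2) (add_comm s t ▸ key t s b a ih2 ih1)

theorem BR.lbr (l : List ι) (hl : l ≠ []) : BR g (l : Multiset ι) (lbr (l.map g)) := by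
  induction l using List.reverseRecOn with
  | nil => exact absurd rfl hl
  | append_singleton l a ih =>
    by_cases h : l = []
    · subst h; exact BR.gen a
    · rw [List.map_append, List.map_singleton, lbr_append _ (by simpa using h), ← Multiset.coe_add]
      exact BR.br (ih h) (BR.gen a)

theorem BR.filt {T : Type} [Ring T] {I : ℕ → AddSubgroup T} (F : Filt I) (f : S →+* T)
    (hg : ∀ i, f (g i) ∈ I 1) {s : Multiset ι} {a : S} (h : BR g s a) : f a ∈ I s.card := by
  induction h with
  | gen i => simpa using hg i
  | @br s t a b _ _ ih1 ih2 =>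
    rw [map_sub, map_mul, map_mul, Multiset.card_add]
    exact sub_mem (F.mul _ _ _ _ ih1 ih2) (by rw [add_comm]; exact F.mul _ _ _ _ ih2 ih1)

def LamB (g : ι → S) {T : Type} [Ring T] (f : S →+* T) (p ℓ : ℕ) (c : ι → ℕ) (d k : ℕ) :
    AddSubgroup T :=
  AddSubgroup.closure {b | ∃ s a μ, BR g s a ∧ s.card = d ∧ μ ≤ s ∧ k ≤ d * ℓ + (μ.map c).sum ∧
    b = (p ^ (μ.map c).sum) • f a}

theorem LamB_sys {T : Type} [Ring T] {I : ℕ → AddSubgroup T} (F : Filt I) (f : S →+* T)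
    (hg : ∀ i, f (g i) ∈ I 1) (p ℓ : ℕ) (c : ι → ℕ) : LamSys I (LamB g f p ℓ c) where
  filt := F
  le := by
    intro d k
    refine (AddSubgroup.closure_le _).2 ?_
    rintro b ⟨s, a, μ, h1, h2, h3, h4, rfl⟩
    exact nsmul_mem (h2 ▸ h1.filt F f hg) _
  anti := by
    intro d k k' hk
    refine AddSubgroup.closure_mono ?_
    rintro b ⟨s, a, μ, h1, h2, h3, h4, h5⟩
    exact ⟨s, a, μ, h1, h2, h3, by omega, h5⟩
  br := by
    intro d e i j a b ha hb
    induction ha using AddSubgroup.closure_induction with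
    | mem x hx =>
      induction hb using AddSubgroup.closure_induction with
      | mem y hy =>
        obtain ⟨s, a, μ, h1, h2, h3, h4, rfl⟩ := hx
        obtain ⟨t, b, ν, h1', h2', h3', h4', rfl⟩ := hy
        refine AddSubgroup.subset_closure ⟨s + t, a * b - b * a, μ + ν, h1.br h1', ?_, ?_, ?_, ?_⟩
        · rw [Multiset.card_add, h2, h2']
        · exact add_le_add h3 h3'
        · rw [Multiset.map_add, Multiset.sum_add, add_mul]; omega
        · rw [Multiset.map_add, Multiset.sum_add, map_sub, map_mul, map_mul, smul_mul_smul_comm,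
            smul_mul_smul_comm, ← pow_add, ← pow_add, smul_sub, add_comm (ν.map c).sum]
      | zero => rw [mul_zero, zero_mul, sub_zero]; exact zero_mem _
      | add y z _ _ hy hz =>
        have : x * (y + z) - (y + z) * x = (x * y - y * x) + (x * z - z * x) := by noncomm_ring
        rw [this]; exact add_mem hy hz
      | neg y _ hy =>
        have : x * (-y) - (-y) * x = -(x * y - y * x) := by noncomm_ring
        rw [this]; exact neg_mem hy
    | zero => rw [mul_zero, zero_mul, sub_zero]; exact zero_mem _
    | add y z _ _ hy hz =>
      have : (y + z) * b - b * (y + z) = (y * b - b * y) + (z * b - b * z) := by noncomm_ring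
      rw [this]; exact add_mem hy hz
    | neg y _ hy =>
      have : (-y) * b - b * (-y) = -(y * b - b * y) := by noncomm_ring
      rw [this]; exact neg_mem hy

end

open scoped commutatorElement

section
variable (m : ℕ) [NeZero m]

abbrev RR := Module.End ℤ (List (Fin m) → ℤ)

def Nc {m : ℕ} [NeZero m] (i j : Fin m) : ℤ :=
  if i = 0 then (if j = 0 then 0 else -1) else if i = j then 1 else 0

theorem Nc_sum (j : Fin m) : ∑ i, Nc i j = 0 := by
  rw [← Finset.add_sum_erase _ _ (Finset.mem_univ (0 : Fin m))]
  have : ∀ i ∈ Finset.univ.erase (0 : Fin m), Nc i j = if i = j then 1 else 0 := by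
    intro i hi
    simp [Nc, Finset.ne_of_mem_erase hi]
  rw [Finset.sum_congr rfl this, Finset.sum_ite_eq']
  by_cases h : j = 0 <;> simp [Nc, h]

def eE (i : Fin m) : RR m where
  toFun f w := if w.length < m then ∑ j, Nc i j * f (w ++ [j]) else 0
  map_add' f f' := by
    funext w
    by_cases h : w.length < m <;> simp [h, mul_add, Finset.sum_add_distrib]
  map_smul' z f := by
    funext w
    by_cases h : w.length < m
    · simp only [h, if_true, Pi.smul_apply, smul_eq_mul, Finset.mul_sum, RingHom.id_apply]
      exact Finset.sum_congr rfl fun _ _ => by ring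
    · simp [h]

theorem eE_apply (i : Fin m) (f : List (Fin m) → ℤ) (w : List (Fin m)) :
    eE m i f w = if w.length < m then ∑ j, Nc i j * f (w ++ [j]) else 0 := rfl

theorem eE_sum : ∑ i, eE m i = 0 := by
  ext f w
  rw [LinearMap.sum_apply, Finset.sum_apply]
  simp only [eE_apply]
  by_cases h : w.length < m
  · simp only [h, if_true]
    rw [Finset.sum_comm]
    simp only [← Finset.sum_mul, Nc_sum]
    simp
  · simp [h]

def II (d : ℕ) : AddSubgroup (RR m) where
  carrier := {r | ∀ w f, (∀ w' : List (Fin m), w.length + d ≤ w'.length → f w' = 0) → r f w = 0}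
  zero_mem' := fun w f _ => rfl
  add_mem' := fun {a b} ha hb w f h => by
    change a f w + b f w = 0
    rw [ha w f h, hb w f h, add_zero]
  neg_mem' := fun {a} ha w f h => by
    change - a f w = 0
    rw [ha w f h, neg_zero]

theorem II_filt : Filt (II m) where
  one := fun w f h => h w (by simp)
  anti := fun i j hij r hr w f h => hr w f fun w' hw' => h w' (by omega)
  mul := fun i j a b ha hb w f h => by
    change a (b f) w = 0
    exact ha w _ fun w' hw' => hb w' f fun w'' hw'' => h w'' (by omega)

theorem eE_mem (i : Fin m) : eE m i ∈ II m 1 := by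
  intro w f h
  rw [eE_apply]
  split_ifs
  · exact Finset.sum_eq_zero fun j _ => by rw [h _ (by simp), mul_zero]
  · rfl

theorem eE_nil (i : Fin m) : eE m i ^ (m + 1) = 0 := by
  have key : ∀ k (f : List (Fin m) → ℤ) (w : List (Fin m)), m < w.length + k → 
      1 ≤ k → (eE m i ^ k) f w = 0 := by
    intro k
    induction k with
    | zero => intro f w h h1; omega
    | succ k ih =>
      intro f w h _
      rw [pow_succ']
      change eE m i ((eE m i ^ k) f) w = 0
      rw [eE_apply]
      split_ifs with h2
      · refine Finset.sum_eq_zero fun j _ => ?_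
        rw [ih f (w ++ [j]) (by simp; omega) (by omega), mul_zero]
      · rfl
  ext f w
  exact key (m + 1) f w (by omega) (by omega)

theorem eE_not_prefix (l : List (Fin m)) (u : List (Fin m)) : ∀ w : List (Fin m), ¬ w <+: u →
    (l.map (eE m)).prod (Pi.single u 1) w = 0 := by
  induction l with
  | nil =>
    intro w h
    have : w ≠ u := fun e => h (e ▸ List.prefix_rfl)
    simp [this]
  | cons i l ih =>
    intro w h
    rw [List.map_cons, List.prod_cons]
    change eE m i ((l.map (eE m)).prod (Pi.single u 1)) w = 0
    rw [eE_apply]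
    split_ifs
    · refine Finset.sum_eq_zero fun j _ => ?_
      rw [ih _ fun h' => h ((List.prefix_append _ _).trans h'), mul_zero]
    · rfl

theorem eE_word (l : List (Fin m × Fin m)) : ∀ w : List (Fin m), w.length + l.length ≤ m →
    ((l.map Prod.fst).map (eE m)).prod (Pi.single (w ++ l.map Prod.snd) 1) w =
      (l.map fun q => Nc q.1 q.2).prod := by
  induction l with
  | nil => intro w _; simp
  | cons q l ih =>
    intro w h
    rw [List.map_cons, List.map_cons, List.map_cons, List.prod_cons, List.map_cons, List.prod_cons]
    change eE m q.1 (((l.map Prod.fst).map (eE m)).prod _) w = _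
    rw [List.length_cons] at h
    rw [eE_apply, if_pos (by omega), Finset.sum_eq_single q.2]
    · congr 1
      have := ih (w ++ [q.2]) (by simp; omega)
      rw [List.append_assoc, List.singleton_append] at this
      exact this
    · intro j _ hj
      rw [eE_not_prefix, mul_zero]
      rw [List.prefix_append_right_inj]
      intro h'
      have := List.cons_prefix_cons.1 h'
      exact hj this.1
    · simp

def kap (v : Fin m → Fin m) : RR m →+ ℤ where
  toFun r := r (Pi.single (List.ofFn v) 1) []
  map_zero' := rfl
  map_add' _ _ := rfl

theorem kap_II (v : Fin m → Fin m) (r : RR m) (h : r ∈ II m (m + 1)) : kap m v r = 0 := by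
  refine h _ _ fun w' hw' => ?_
  have : w' ≠ List.ofFn v := by
    intro e; rw [e] at hw'; simp at hw'
  simp [this]

theorem kap_Xw (v : Fin m → Fin m) (τ : Equiv.Perm (Fin m)) :
    kap m v (Xw (eE m) τ) = ∏ k, Nc (τ k) (v k) := by
  have := eE_word m (List.ofFn fun k => (τ k, v k)) [] (by simp)
  rw [List.map_ofFn, List.map_ofFn, List.map_ofFn, List.map_ofFn, List.prod_ofFn] at this
  exact this

theorem Nc_pair (τ₀ : Equiv.Perm (Fin m)) (i : Fin m) (hi : i ≠ 0) (y : Equiv.Perm (Fin m) → ℤ) :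
    ∑ τ, y τ * ∏ k, Nc (τ k) (if τ₀ k = 0 then i else τ₀ k) = -(y τ₀ + y (Equiv.swap 0 i * τ₀)) := by
  have hne : τ₀ ≠ Equiv.swap 0 i * τ₀ := by
    intro h
    have h1 : (1 : Equiv.Perm (Fin m)) = Equiv.swap 0 i := by
      have : 1 * τ₀ = Equiv.swap 0 i * τ₀ := by rw [one_mul]; exact h
      exact mul_right_cancel this
    have h2 := congrArg (fun σ : Equiv.Perm (Fin m) => σ 0) h1
    simp at h2
    exact hi h2.symm
  rw [Fintype.sum_eq_add τ₀ (Equiv.swap 0 i * τ₀) hne]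
  · have f1 : ∏ k, Nc (τ₀ k) (if τ₀ k = 0 then i else τ₀ k) = -1 := by
      rw [Finset.prod_eq_single (τ₀.symm 0)]
      · simp [Nc, hi]
      · intro k _ hk
        have : τ₀ k ≠ 0 := fun h => hk (by rw [← h]; simp)
        simp [Nc, this]
      · simp
    have f2 : ∏ k, Nc ((Equiv.swap 0 i * τ₀) k) (if τ₀ k = 0 then i else τ₀ k) = -1 := by
      rw [Finset.prod_eq_single (τ₀.symm i)]
      · simp [Nc, hi]
      · intro k _ hk
        have hk' : τ₀ k ≠ i := fun h => hk (by rw [← h]; simp)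
        by_cases h0 : τ₀ k = 0
        · simp [Nc, h0, hi]
        · rw [Equiv.Perm.mul_apply, Equiv.swap_apply_of_ne_of_ne h0 hk']
          simp [Nc, h0]
      · simp
    rw [f1, f2]; ring
  · intro τ ⟨h1, h2⟩
    by_contra hne0
    have hall : ∀ k, Nc (τ k) (if τ₀ k = 0 then i else τ₀ k) ≠ 0 := by
      intro k hk
      exact hne0 (by rw [Finset.prod_eq_zero (Finset.mem_univ k) hk, mul_zero])
    have hv : ∀ k, τ k ≠ 0 → τ k = if τ₀ k = 0 then i else τ₀ k := by
      intro k hk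
      have := hall k
      unfold Nc at this
      rw [if_neg hk] at this
      by_contra h
      rw [if_neg h] at this
      exact this rfl
    by_cases hk0 : τ (τ₀.symm 0) = 0
    · refine h1 (Equiv.ext fun k => ?_)
      by_cases h : τ₀ k = 0
      · have : k = τ₀.symm 0 := by rw [← h]; simp
        rw [h, this, hk0]
      · have : τ k ≠ 0 := fun h' => h (by
          have := τ.injective (h'.trans hk0.symm)
          rw [this]; simp)
        rw [hv k this, if_neg h]
    · have e0 := hv _ hk0
      rw [if_pos (by simp)] at e0
      have e1 : τ (τ₀.symm i) = 0 := by
        by_contra h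
        have e2 := hv _ h
        rw [Equiv.apply_symm_apply, if_neg hi] at e2
        exact hi (τ₀.symm.injective (τ.injective (e2.trans e0.symm)))
      refine h2 (Equiv.ext fun k => ?_)
      rw [Equiv.Perm.mul_apply]
      by_cases h : τ₀ k = 0
      · have : k = τ₀.symm 0 := by rw [← h]; simp
        rw [h, this, e0, Equiv.swap_apply_left]
      · by_cases h' : τ₀ k = i
        · have : k = τ₀.symm i := by rw [← h']; simp
          rw [h', this, e1, Equiv.swap_apply_right]
        · rw [Equiv.swap_apply_of_ne_of_ne h h']
          have : τ k ≠ 0 := fun h'' => h' (by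
            have := τ.injective (h''.trans e1.symm)
            rw [this]; simp)
          rw [hv k this, if_neg h]

theorem sgn_of_pair {A : Type} [CommRing A] (Y : Equiv.Perm (Fin m) → A)
    (h : ∀ τ i, i ≠ 0 → Y (Equiv.swap 0 i * τ) = - Y τ) (τ : Equiv.Perm (Fin m)) :
    Y τ = ((Equiv.Perm.sign τ : ℤ) : A) * Y 1 := by
  have hs : ∀ a b, a ≠ b → ∀ τ, Y (Equiv.swap a b * τ) = - Y τ := by
    intro a b hab τ
    by_cases ha : a = 0
    · subst ha; exact h τ b (Ne.symm hab)
    · by_cases hb : b = 0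
      · subst hb; rw [Equiv.swap_comm]; exact h τ a hab
      · have e : Equiv.swap a b = Equiv.swap 0 a * Equiv.swap 0 b * Equiv.swap 0 a := by
          rw [Equiv.swap_comm 0 b, Equiv.swap_mul_swap_mul_swap hb (Ne.symm hab)]
        rw [e, mul_assoc, mul_assoc, h _ _ ha, h _ _ hb, h _ _ ha]; simp
  induction τ using Equiv.Perm.swap_induction_on with
  | one => simp
  | swap_mul f x y hxy ih =>
    rw [hs x y hxy, ih, Equiv.Perm.sign_mul, Equiv.Perm.sign_swap hxy]
    simp

end

open scoped commutatorElement

theorem digits_uniq (b : ℕ) : ∀ (k : ℕ) (f g : Fin k → ℕ), (∀ i, f i < b) → (∀ i, g i < b) →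
    ∑ i, f i * b ^ i.val = ∑ i, g i * b ^ i.val → f = g := by
  intro k
  induction k with
  | zero => intro f g _ _ _; exact Subsingleton.elim _ _
  | succ k ih =>
    intro f g hf hg h
    rw [Fin.sum_univ_succ, Fin.sum_univ_succ] at h
    have e : ∀ f : Fin (k + 1) → ℕ, ∑ i : Fin k, f i.succ * b ^ (i.succ).val =
        b * ∑ i : Fin k, f i.succ * b ^ i.val := by
      intro f
      rw [Finset.mul_sum]
      exact Finset.sum_congr rfl fun i _ => by rw [Fin.val_succ, pow_succ]; ring
    rw [e, e] at h
    simp only [Fin.val_zero, pow_zero, mul_one] at h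
    have h0 : f 0 = g 0 := by
      have := congrArg (· % b) h
      simpa [Nat.mod_eq_of_lt (hf 0), Nat.mod_eq_of_lt (hg 0)] using this
    have hb : 0 < b := lt_of_le_of_lt (Nat.zero_le _) (hf 0)
    rw [h0] at h
    have h1 := Nat.eq_of_mul_eq_mul_left hb (Nat.add_left_cancel h)
    have h2 := ih (fun i => f i.succ) (fun i => g i.succ) (fun i => hf _) (fun i => hg _) h1
    funext i
    refine Fin.cases h0 (fun i => congrFun h2 i) i

theorem mu_univ (m : ℕ) (μ s : Multiset (Fin m)) (hs : s.card = m) (h : μ ≤ s)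
    (he : (μ.map fun i => (m + 1) ^ i.val).sum = ∑ i : Fin m, (m + 1) ^ i.val) :
    s = Finset.univ.val := by
  have hμ : μ.card ≤ m := (Multiset.card_le_card h).trans hs.le
  have e1 : (μ.map fun i => (m + 1) ^ i.val).sum = ∑ i : Fin m, μ.count i * (m + 1) ^ i.val := by
    rw [Finset.sum_multiset_map_count]
    simp only [smul_eq_mul]
    refine Finset.sum_subset (Finset.subset_univ _) fun i _ hi => ?_
    rw [Multiset.mem_toFinset] at hi
    rw [Multiset.count_eq_zero_of_notMem hi, zero_mul]
  rw [e1] at he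
  have e2 := digits_uniq (m + 1) m (fun i => μ.count i) (fun _ => 1)
    (fun i => by have := Multiset.count_le_card i μ; omega) (fun i => by have := i.pos; omega)
    (by simpa using he)
  have e3 : μ = Finset.univ.val := by
    ext i
    rw [congrFun e2 i, Multiset.count_eq_one_of_mem Finset.univ.nodup (Finset.mem_univ i)]
  have e4 : μ = s := Multiset.eq_of_le_of_card_le h (by rw [hs, e3]; simp)
  rw [← e4, e3]

theorem list_perm {m : ℕ} (l : List (Fin m)) (h : (l : Multiset (Fin m)) = Finset.univ.val) :
    ∃ τ : Equiv.Perm (Fin m), l = List.ofFn fun k => τ k := by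
  have hn : l.Nodup := by rw [← Multiset.coe_nodup, h]; exact Finset.univ.nodup
  have hl : l.length = m := by
    have := congrArg Multiset.card h
    simpa using this
  have hl' := hl.symm
  have inj : Function.Injective (fun k : Fin m => l.get (k.cast hl')) := by
    intro a b hab
    have := (List.nodup_iff_injective_get.1 hn) hab
    simpa using this
  refine ⟨Equiv.ofBijective _ (Finite.injective_iff_bijective.1 inj), ?_⟩
  apply List.ext_get
  · simp [hl]
  · intro n h1 h2; simp

section
variable (p : ℕ) [NeZero (2 * p)]

noncomputable def gen2 (i : Fin (2 * p)) : RR (2 * p) × BA (2 * p) := (eE (2 * p) i, bX i)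

theorem Xw_map {S T : Type} [Ring S] [Ring T] {m : ℕ} (f : S →+* T) (X : Fin m → S)
    (τ : Equiv.Perm (Fin m)) : f (Xw X τ) = Xw (fun i => f (X i)) τ := by
  unfold Xw
  rw [map_list_prod, List.map_ofFn]; rfl

theorem br_zero (hp : p.Prime) {a : RR (2 * p) × BA (2 * p)} {s : Multiset (Fin (2 * p))}
    (h : BR (gen2 p) s a) (hs : s = Finset.univ.val) : a.2 = 0 := by
  have h2 := hp.two_le
  refine BR.mixed (RingHom.snd _ _) (fun i : Fin (2 * p) => i.val < 2) ?_ h ?_ ?_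
  · intro i j hi hj
    exact bX_comm i j hi (by omega)
  · exact ⟨⟨0, by omega⟩, by rw [hs]; exact Finset.mem_univ (α := Fin (2 * p)) _, by simp⟩
  · exact ⟨⟨2, by omega⟩, by rw [hs]; exact Finset.mem_univ (α := Fin (2 * p)) _, by simp⟩

theorem lbr_map {S T : Type} [Ring S] [Ring T] (f : S →+* T) (l : List S) :
    f (lbr l) = lbr (l.map f) := by
  induction l using List.reverseRecOn with
  | nil => simp [lbr]
  | append_singleton l a ih =>
    by_cases h : l = []
    · subst h; simp [lbr]
    · rw [lbr_append l h, List.map_append, List.map_singleton, lbr_append _ (by simpa using h),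
        map_sub, map_mul, map_mul, ih]

theorem lam_bX (hp : p.Prime) : lam (bX (m := 2 * p)) = 0 := by
  unfold lam
  refine Finset.sum_eq_zero fun τ _ => ?_
  have h1 : (List.ofFn fun k => τ k) ≠ [] := by
    intro h
    have := congrArg List.length h
    simp at this
    have := hp.pos; omega
  have h2 := BR.lbr (g := gen2 p) (List.ofFn fun k => τ k) h1
  have h3 := br_zero p hp h2 (by
    have hn : (List.ofFn fun k => τ k).Nodup := List.nodup_ofFn.2 τ.injective
    have : (Finset.univ : Finset (Fin (2 * p))) = ⟨_, Multiset.coe_nodup.2 hn⟩ := by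
      ext i
      simp only [Finset.mem_univ, Finset.mem_mk, Multiset.mem_coe, List.mem_ofFn, true_iff]
      exact ⟨τ.symm i, by simp⟩
    rw [this])
  have h4 := lbr_map (RingHom.snd (RR (2 * p)) (BA (2 * p))) ((List.ofFn fun k => τ k).map (gen2 p))
  have h4' := h4.symm.trans h3
  rw [List.map_map, List.map_ofFn] at h4'
  have h5 : lbr (List.ofFn fun k => bX (τ k)) = (0 : BA (2 * p)) := h4'
  rw [h5, smul_zero]

theorem Lam_top (hp : p.Prime) (ℓ C : ℕ) (hC : C = ∑ i : Fin (2 * p), (2 * p + 1) ^ i.val)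
    (α : RR (2 * p))
    (hα : α ∈ LamB (gen2 p) (RingHom.fst _ _) p ℓ (fun i => (2 * p + 1) ^ i.val) (2 * p)
      (2 * p * ℓ + C)) :
    ∃ (z : Equiv.Perm (Fin (2 * p)) → ℤ) (t : RR (2 * p)),
      α = (p ^ C) • ∑ τ, z τ • Xw (eE (2 * p)) τ + (p ^ (C + 1)) • t ∧
      ∑ τ, z τ • Xw (bX (m := 2 * p)) τ = 0 := by
  induction hα using AddSubgroup.closure_induction with
  | zero => exact ⟨0, 0, by simp, by simp⟩
  | add a b _ _ ha hb =>
    obtain ⟨z, t, h1, h2⟩ := ha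
    obtain ⟨z', t', h1', h2'⟩ := hb
    refine ⟨z + z', t + t', ?_, ?_⟩
    · simp only [Pi.add_apply, add_smul, Finset.sum_add_distrib, smul_add]
      rw [h1, h1']; abel
    · simp only [Pi.add_apply, add_smul, Finset.sum_add_distrib]
      rw [h2, h2', add_zero]
  | neg a _ ha =>
    obtain ⟨z, t, h1, h2⟩ := ha
    refine ⟨-z, -t, ?_, ?_⟩
    · simp only [Pi.neg_apply, neg_smul, Finset.sum_neg_distrib, smul_neg]
      rw [h1]; abel
    · simp only [Pi.neg_apply, neg_smul, Finset.sum_neg_distrib]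
      rw [h2, neg_zero]
  | mem b hb =>
    obtain ⟨s, a, μ, h1, h2, h3, h4, rfl⟩ := hb
    have h5 : C ≤ (μ.map fun i => (2 * p + 1) ^ i.val).sum := by omega
    rcases h5.eq_or_lt with h5 | h5
    · have hs := mu_univ (2 * p) μ s h2 h3 (h5.symm.trans hC)
      have h0 := br_zero p hp h1 hs
      have hz : ∀ a : RR (2 * p) × BA (2 * p), 
          a ∈ AddSubgroup.closure {b | ∃ l : List (Fin (2 * p)), (l : Multiset (Fin (2 * p))) = s ∧
            b = (l.map (gen2 p)).prod} →
          ∃ z : Equiv.Perm (Fin (2 * p)) → ℤ, a = ∑ τ, z τ • Xw (gen2 p) τ := by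
        intro a ha
        induction ha using AddSubgroup.closure_induction with
        | zero => exact ⟨0, by simp⟩
        | add a b _ _ ha hb =>
          obtain ⟨z, h1⟩ := ha
          obtain ⟨z', h1'⟩ := hb
          refine ⟨z + z', ?_⟩
          simp only [Pi.add_apply, add_smul, Finset.sum_add_distrib]
          rw [h1, h1']
        | neg a _ ha =>
          obtain ⟨z, h1⟩ := ha
          refine ⟨-z, ?_⟩
          simp only [Pi.neg_apply, neg_smul, Finset.sum_neg_distrib]
          rw [h1]
        | mem b hb =>
          obtain ⟨l, h1, rfl⟩ := hb
          obtain ⟨τ, rfl⟩ := list_perm l (h1.trans hs)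
          refine ⟨Pi.single τ 1, ?_⟩
          rw [Finset.sum_eq_single τ]
          · rw [Pi.single_eq_same, one_smul, List.map_ofFn]; rfl
          · intro σ _ hσ; rw [Pi.single_eq_of_ne hσ, zero_smul]
          · simp
      obtain ⟨z, hz⟩ := hz a h1.span
      refine ⟨z, 0, ?_, ?_⟩
      · rw [← h5, smul_zero, add_zero, hz, map_sum]
        congr 1
        refine Finset.sum_congr rfl fun τ _ => ?_
        rw [map_zsmul, Xw_map]; rfl
      · rw [← h0]
        change _ = RingHom.snd _ _ a
        rw [hz, map_sum]
        refine Finset.sum_congr rfl fun τ _ => ?_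
        rw [map_zsmul, Xw_map]; rfl
    · refine ⟨0, (p ^ ((μ.map fun i => (2 * p + 1) ^ i.val).sum - (C + 1))) • a.1, ?_, by simp⟩
      rw [smul_smul, ← pow_add, Nat.add_sub_cancel' h5]
      simp

theorem not_Lam (hp : p.Prime) (ℓ C : ℕ) (hC : C = ∑ i : Fin (2 * p), (2 * p + 1) ^ i.val)
    (hC1 : 1 ≤ C) (α : RR (2 * p))
    (hα : α ∈ LamB (gen2 p) (RingHom.fst _ _) p ℓ (fun i => (2 * p + 1) ^ i.val) (2 * p)
      (2 * p * ℓ + C))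
    (h : ((p : ℤ) ^ (C - 1)) • lam (eE (2 * p)) - α ∈ II (2 * p) (2 * p + 1)) : False := by
  obtain ⟨z, t, h1, h2⟩ := Lam_top p hp ℓ C hC α hα
  obtain ⟨a, ha⟩ := lam_identity p hp
  have hp0 : (p : ℤ) ≠ 0 := by exact_mod_cast hp.ne_zero
  have hlam : lam (eE (2 * p)) = (p : ℤ) • ∑ τ, a τ • Xw (eE (2 * p)) τ := by
    have e := ha _ (eE (2 * p))
    have e2 : ∑ τ, (Equiv.Perm.sign τ : ℤ) • Xw (eE (2 * p)) τ = 0 := Sgn_zero _ (eE_sum _)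
    rw [e, e2, add_zero]
  have hy : ∀ v, ∑ τ, (a τ - z τ) * ∏ k, Nc (τ k) (v k) = p * kap (2 * p) v t := by
    intro v
    have h3 := kap_II _ v _ h
    rw [hlam, h1, smul_smul, ← pow_succ, Nat.sub_add_cancel hC1, map_sub, map_add, map_zsmul,
      map_nsmul, map_nsmul, map_sum, map_sum] at h3
    simp only [map_zsmul, kap_Xw, nsmul_eq_mul, smul_eq_mul, Nat.cast_pow] at h3
    simp only [sub_mul, Finset.sum_sub_distrib]
    have h4 : (p : ℤ) ^ C ≠ 0 := pow_ne_zero _ hp0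
    apply mul_left_cancel₀ h4
    rw [pow_succ] at h3
    linear_combination h3
  have : Fact p.Prime := ⟨hp⟩
  have hY := sgn_of_pair (2 * p) (A := ZMod p) (fun τ => ((a τ - z τ : ℤ) : ZMod p)) (by
    intro τ i hi
    have h3 := hy (fun k => if τ k = 0 then i else τ k)
    rw [Nc_pair (2 * p) τ i hi fun τ => a τ - z τ] at h3
    have h4 := congrArg (Int.cast : ℤ → ZMod p) h3
    push_cast at h4 ⊢
    rw [CharP.cast_eq_zero, zero_mul] at h4
    linear_combination -h4)
  have hb1 := congrArg (bphi (2 * p)) h2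
  rw [map_sum, map_zero] at hb1
  simp only [map_zsmul, smul_eq_mul] at hb1
  have hS := bphi_Sgn p hp
  unfold Sgn at hS
  have hb2 := congrArg (bphi (2 * p)) (ha _ (bX (m := 2 * p)))
  rw [lam_bX p hp, map_add, hS, map_zero, map_zsmul, map_sum] at hb2
  rw [map_sum] at hS
  simp only [map_zsmul, smul_eq_mul] at hb2 hS
  have hb3 : ∑ τ, a τ * bphi (2 * p) (Xw bX τ) = -1 := by
    apply mul_left_cancel₀ hp0
    linear_combination -hb2
  have hb4 : ∑ τ, (a τ - z τ) * bphi (2 * p) (Xw bX τ) = -1 := by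
    simp only [sub_mul, Finset.sum_sub_distrib]
    rw [hb3, hb1, sub_zero]
  have hb5 := congrArg (Int.cast : ℤ → ZMod p) hb4
  have hS' := congrArg (Int.cast : ℤ → ZMod p) hS
  rw [Int.cast_sum] at hb5 hS'
  simp only [Int.cast_mul] at hb5 hS'
  rw [Finset.sum_congr rfl fun τ _ => congrArg (· * _) (hY τ)] at hb5
  have hb6 : (((a 1 - z 1 : ℤ) : ZMod p)) * ∑ τ : Equiv.Perm (Fin (2 * p)),
      ((Equiv.Perm.sign τ : ℤ) : ZMod p) * (bphi (2 * p) (Xw bX τ) : ZMod p) = ((-1 : ℤ) : ZMod p) := by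
    rw [← hb5, Finset.mul_sum]
    exact Finset.sum_congr rfl fun τ _ => by ring
  rw [hS'] at hb6
  simp at hb6

end

open scoped commutatorElement

theorem exists_h (m : ℕ) [NeZero m] : ∃ h : Fin m → (RR m)ˣ,
    (∀ i, Lead (II m) (h i) 1 (eE m i)) ∧ (List.ofFn h).prod = 1 := by
  choose u hu _ using fun i => unit_of_nil (II_filt m) (eE m i) (eE_mem m i) (m + 1) (eE_nil m i)
  have hs := eE_sum m
  rcases m with _ | k
  · exact absurd rfl (NeZero.ne 0)
  · refine ⟨Fin.cons ((List.ofFn (fun i : Fin k => u i.succ)).prod)⁻¹ (fun i => u i.succ), ?_, ?_⟩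
    · intro i
      refine Fin.cases ?_ (fun i => ?_) i
      · rw [Fin.cons_zero]
        have h1 := Lead.listProd (II_filt (k + 1)) le_rfl (fun i : Fin k => u i.succ)
          (fun i : Fin k => eE (k + 1) i.succ) (List.ofFn id) (fun i _ => hu i.succ)
        rw [List.map_ofFn, List.map_ofFn, List.sum_ofFn] at h1
        have h2 := h1.inv (II_filt (k + 1)) le_rfl
        refine h2.congr ?_
        rw [Fin.sum_univ_succ] at hs
        exact (eq_neg_of_add_eq_zero_left hs).symm
      · rw [Fin.cons_succ]; exact hu i.succ
    · rw [List.ofFn_succ, List.prod_cons]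
      simp

theorem comap_NSer {G N : Type} [Group G] [Group N] {D : ℕ → Subgroup N} (h : NSer D) (φ : G →* N) :
    NSer (fun k => (D k).comap φ) where
  top := by rw [h.top]; rfl
  anti := fun i j hi hij => Subgroup.comap_mono (h.anti i j hi hij)
  comm := fun i j hi hj a ha b hb => by
    rw [Subgroup.mem_comap] at *
    rw [map_commutatorElement]
    exact h.comm i j hi hj _ ha _ hb

def mainMk (p ℓ : ℕ) (c : Fin (2 * p) → ℕ) : FreeGroup (MainGen p ℓ c) →* MainGroup p ℓ c :=
  PresentedGroup.mk (mainRels p ℓ c)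

theorem mainMk_rel (p ℓ : ℕ) (c : Fin (2 * p) → ℕ) (w : FreeGroup (MainGen p ℓ c))
    (h : w ∈ mainRels p ℓ c) : mainMk p ℓ c w = 1 :=
  PresentedGroup.one_of_mem h

theorem main_hom (p ℓ : ℕ) (c : Fin (2 * p) → ℕ) {N : Type} [Group N] (x : Fin (2 * p) → N)
    (hx : ∀ i, ∃ zs : List N, zs.length = ℓ ∧ leftComm zs = x i)
    (hy : ∀ i, ∃ zs : List N, zs.length = ℓ + c i ∧ leftComm zs = x i ^ p ^ c i)
    (hprod : (List.ofFn x).prod = 1) :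
    ∃ φ : MainGroup p ℓ c →* N, ∀ i, φ (mainMk p ℓ c (xWord p ℓ c i)) = x i := by
  choose zx hx1 hx2 using hx
  choose zy hy1 hy2 using hy
  let F : MainGen p ℓ c → N := Sum.elim (fun q => (zx q.1).get (q.2.cast (hx1 q.1).symm))
    (fun q => (zy q.1).get (q.2.cast (hy1 q.1).symm))
  have ofn : ∀ (k : ℕ) (l : List N) (h : l.length = k),
      (List.ofFn fun j : Fin k => l.get (j.cast h.symm)) = l := by
    intro k l h; subst h; simp
  have e1 : ∀ i, FreeGroup.lift F (xWord p ℓ c i) = x i := by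
    intro i
    rw [xWord, leftComm_map, List.map_ofFn, ← hx2 i]
    congr 1
    refine Eq.trans ?_ (ofn ℓ (zx i) (hx1 i))
    congr 1
    funext j
    simp [F]
  have e2 : ∀ i, FreeGroup.lift F (yWord p ℓ c i) = x i ^ p ^ c i := by
    intro i
    rw [yWord, leftComm_map, List.map_ofFn, ← hy2 i]
    congr 1
    refine Eq.trans ?_ (ofn _ (zy i) (hy1 i))
    congr 1
    funext j
    simp [F]
  have hr : ∀ r ∈ mainRels p ℓ c, FreeGroup.lift F r = 1 := by
    rintro r (rfl | ⟨i, rfl⟩)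
    · rw [map_list_prod, List.map_ofFn, ← hprod]
      congr 2
      funext i
      exact e1 i
    · rw [map_mul, map_inv, map_pow, e1, e2, mul_inv_cancel]
  refine ⟨PresentedGroup.toGroup (rels := mainRels p ℓ c) hr, fun i => ?_⟩
  rw [← e1 i]
  rfl

/-- For every prime `p` there are positive integers `ℓ, n, c_0, …, c_{2p-1}` such that
the group `G` presented above has an element of order `p` in `δ_n(G)/γ_n(G)`. -/
theorem main_theorem_group (p : ℕ) (hp : p.Prime) :
    ∃ (ℓ n : ℕ) (c : Fin (2 * p) → ℕ), 0 < ℓ ∧ 0 < n ∧ (∀ i, 0 < c i) ∧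
      ∃ g : MainGroup p ℓ c,
        g ∈ dimensionSubgroup (MainGroup p ℓ c) n ∧
        g ∉ gammaGrp (MainGroup p ℓ c) n ∧
        g ^ p ∈ gammaGrp (MainGroup p ℓ c) n := by
  have hp2 := hp.two_le
  have : NeZero (2 * p) := ⟨by omega⟩
  obtain ⟨c, hc⟩ : ∃ c : Fin (2 * p) → ℕ, c = fun i => (2 * p + 1) ^ i.val := ⟨_, rfl⟩
  obtain ⟨C, hC⟩ : ∃ C : ℕ, C = ∑ i, c i := ⟨_, rfl⟩
  have hc0 : ∀ i, 0 < c i := fun i => by rw [hc]; exact Nat.pow_pos (by omega)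
  have hci : ∀ i, c i ≤ C := fun i => by
    rw [hC]; exact Finset.single_le_sum (fun _ _ => Nat.zero_le _) (Finset.mem_univ i)
  have hC1 : 1 ≤ C := (hc0 0).trans_le (hci 0)
  obtain ⟨ℓ, hl⟩ : ∃ ℓ : ℕ, ℓ = 2 * p * C := ⟨_, rfl⟩
  have hCl : C ≤ ℓ := by rw [hl]; exact Nat.le_mul_of_pos_left _ (by omega)
  have hxw : ∀ i, ∃ l : List (MainGroup p ℓ c), l.length = ℓ ∧
      mainMk p ℓ c (xWord p ℓ c i) = leftComm l := by
    intro i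
    exact ⟨(List.ofFn fun j : Fin ℓ => FreeGroup.of (Sum.inl (i, j))).map (mainMk p ℓ c), by simp,
      by rw [xWord, leftComm_map]⟩
  have hyw : ∀ i, ∃ l : List (MainGroup p ℓ c), l.length = ℓ + c i ∧
      mainMk p ℓ c (xWord p ℓ c i) ^ p ^ c i = leftComm l := by
    intro i
    have h := mainMk_rel p ℓ c _ (Set.mem_insert_of_mem _ ⟨i, rfl⟩)
    rw [map_mul, map_inv, map_pow, mul_inv_eq_one] at h
    exact ⟨(List.ofFn fun j : Fin (ℓ + c i) => FreeGroup.of (Sum.inr ⟨i, j⟩)).map (mainMk p ℓ c),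
      by simp, by rw [h, yWord, leftComm_map]⟩
  have hpr : (List.ofFn fun i => mainMk p ℓ c (xWord p ℓ c i)).prod = 1 := by
    have h := mainMk_rel p ℓ c _ (Set.mem_insert _ _)
    rw [map_list_prod, List.map_ofFn] at h
    exact h
  have hd := g_delta p hp ℓ C c hC hC1 hCl (fun i => mainMk p ℓ c (xWord p ℓ c i)) hxw hyw hpr
  refine ⟨ℓ, 2 * p * ℓ + C, c, by omega, by omega, hc0, _, hd.1, ?_, hd.2⟩
  intro hg
  obtain ⟨h, hh, hh1⟩ := exists_h (2 * p)
  have sys := LamB_sys (g := gen2 p) (II_filt (2 * p)) (RingHom.fst _ _) (eE_mem (2 * p)) p ℓ c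
  have hzl : ∀ k, 1 ≤ k → k ≤ ℓ + C → zn (ℓ + C) k = 1 := fun k h1 h2 =>
    zn_eq (ℓ + C) k 0 (by omega) (by omega)
  have m1 : ∀ i, h i ∈ DS sys (ℓ + C) ℓ := fun i =>
    ⟨eE (2 * p) i, by
      rw [hzl ℓ (by omega) (by omega)]
      exact AddSubgroup.subset_closure ⟨{i}, gen2 p i, 0, BR.gen i, by simp, by simp, by simp,
        by simp [gen2]⟩, by
      rw [hzl ℓ (by omega) (by omega)]; exact hh i⟩
  have m2 : ∀ i, h i ^ p ^ c i ∈ DS sys (ℓ + C) (ℓ + c i) := fun i =>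
    ⟨(p ^ c i) • eE (2 * p) i, by
      have := hci i
      rw [hzl (ℓ + c i) (by omega) (by omega)]
      exact AddSubgroup.subset_closure ⟨{i}, gen2 p i, {i}, BR.gen i, by simp, le_rfl, by simp,
        by simp [gen2]⟩, by
      have := hci i
      rw [hzl (ℓ + c i) (by omega) (by omega)]
      exact (hh i).pow (II_filt _) le_rfl _⟩
  have ser := DS_NSer sys (ℓ + C) (by omega)
  let hN : Fin (2 * p) → DS sys (ℓ + C) 1 := fun i => ⟨h i, DS_anti sys _ (by omega) (m1 i)⟩
  obtain ⟨N', gN', D', f, ser', ext', hz⟩ := root_family _ ser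
    ((List.ofFn fun i => (hN i, ℓ)) ++ List.ofFn (fun i => (hN i ^ p ^ c i, ℓ + c i))) rfl (by
      intro q hq
      rw [List.mem_append, List.mem_ofFn, List.mem_ofFn] at hq
      rcases hq with ⟨i, rfl⟩ | ⟨i, rfl⟩
      · exact ⟨by change 1 ≤ ℓ; omega, m1 i⟩
      · exact ⟨by change 1 ≤ ℓ + c i; omega, m2 i⟩)
  obtain ⟨φ, hφ⟩ := main_hom p ℓ c (fun i => f (hN i))
    (fun i => hz (hN i, ℓ) (List.mem_append_left _ (List.mem_ofFn.2 ⟨i, rfl⟩)))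
    (fun i => by
      obtain ⟨zs, h1, h2⟩ := hz (hN i ^ p ^ c i, ℓ + c i)
        (List.mem_append_right _ (List.mem_ofFn.2 ⟨i, rfl⟩))
      exact ⟨zs, h1, by rw [h2, map_pow]⟩)
    (by
      have e : (List.ofFn hN).prod = 1 := by
        apply Subtype.ext
        have := map_list_prod (DS sys (ℓ + C) 1).subtype (List.ofFn hN)
        rw [List.map_ofFn] at this
        exact this.trans hh1
      have := congrArg f e
      rw [map_list_prod, List.map_ofFn, map_one] at this
      exact this)
  have hg2 := (comap_NSer ser' φ).gamma_le (2 * p * ℓ + C - 1) hg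
  rw [Nat.sub_add_cancel (by omega), Subgroup.mem_comap, gElt_map] at hg2
  simp only [hφ] at hg2
  rw [← gElt_map] at hg2
  have hg3 := (ext' _ (by omega) _).2 hg2
  have hg4 : (DS sys (ℓ + C) 1).subtype (gElt ((p : ℤ) ^ (C - 1)) hN) ∈
    DS sys (ℓ + C) (2 * p * ℓ + C) := hg3
  rw [gElt_map] at hg4
  obtain ⟨α, hα, hlead⟩ := hg4
  have hzn : zn (ℓ + C) (2 * p * ℓ + C) = 2 * p := by
    obtain ⟨t, ht⟩ : ∃ t, 2 * p = t + 1 := ⟨2 * p - 1, by omega⟩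
    rw [ht] at hl ⊢
    refine zn_eq _ _ t ?_ ?_
    · nlinarith
    · nlinarith
  rw [hzn] at hα hlead
  have hlead2 := Lead.gElt (II_filt (2 * p)) ((p : ℤ) ^ (C - 1)) h (eE (2 * p)) hh
  have hdiff := sub_mem hlead.2.2 hlead2.2.2
  refine not_Lam p hp ℓ C (by rw [hC, hc]) hC1 α (by rw [hc] at hα; exact hα) ?_
  convert hdiff using 1
  change _ = (gElt ((p : ℤ) ^ (C - 1)) h).val - 1 - α - _
  abel
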